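/- arXiv:1902.06164 — 4 statements merged into one kernel-verified Lean document; each statement's English description precedes it below -/
import Mathlib

section
/- For every δ > 0 there exist constants L ∈ ℕ, ε₁ > 0 and n₀ ∈ ℕ such that the following holds. For any p ∈ (0, 1/3] and any 0 < ε < ε₁, let G be a (p,λ)-bijumbled graph on n ≥ n₀ vertices with λ ≤ ε p² n and minimum degree δ(G) ≥ δ p n. Then for any integers ℓ₁, …, ℓ_t with L + 1 ≤ ℓᵢ ≤ n for each i and ℓ₁ + ⋯ + ℓ_t ≤ n, the graph G contains t vertex-disjoint cycles of lengths ℓ₁, …, ℓ_t. -/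
open Finset

/-- The number of pairs `(a,b) ∈ A × B` with `ab` an edge of `G`
(edges inside `A ∩ B` are counted twice). -/
def ePairs {V : Type} [DecidableEq V] (G : SimpleGraph V) [DecidableRel G.Adj]
    (A B : Finset V) : ℕ :=
  ((A ×ˢ B).filter fun ab => G.Adj ab.1 ab.2).card

/-- `G` is `(p,λ)`-bijumbled: `|e(A,B) − p|A||B|| < λ√(|A||B|)` for all (nonempty)
vertex subsets `A, B`. -/
def Bijumbled {V : Type} [Fintype V] [DecidableEq V] (G : SimpleGraph V)
    [DecidableRel G.Adj] (p lam : ℝ) : Prop :=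
  ∀ A B : Finset V, A.Nonempty → B.Nonempty →
    |(ePairs G A B : ℝ) - p * A.card * B.card| < lam * Real.sqrt (A.card * B.card)

section Expander

lemma card_perm_mapsTo_mul_le {α : Type*} [Fintype α] [DecidableEq α] (S T : Finset α) :
    #{π : Equiv.Perm α | ∀ a ∈ S, π a ∈ T} * Fintype.card α ^ #S ≤
      #T ^ #S * (Fintype.card α).factorial := by
  classical
  induction S using Finset.induction_on with
  | empty => simp [Fintype.card_perm]
  | insert a S ha ih =>
    set A' := ({π : Equiv.Perm α | ∀ x ∈ S, π x ∈ T} : Finset _) with hA'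
    set A := ({π : Equiv.Perm α | ∀ x ∈ insert a S, π x ∈ T} : Finset _) with hA
    have hcount : #A * (Fintype.card α - #S) = #A' * (#T - #S) := by
      have h1 : #(A.sigma fun _ => Sᶜ) = #A * (Fintype.card α - #S) := by
        rw [card_sigma]; simp [card_compl]
      have h2 : #(A'.sigma fun π => {b ∈ Sᶜ | π b ∈ T}) = #A' * (#T - #S) := by
        rw [card_sigma]
        rw [sum_const_nat (m := #T - #S)]
        intro π hπ
        have hπ' : ∀ x ∈ S, π x ∈ T := by simpa [hA'] using hπ
        have : ({b ∈ Sᶜ | π b ∈ T} : Finset α) = (T.map π.symm.toEmbedding) \ S := by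
          ext b; simp [and_comm]
        rw [this, card_sdiff_of_subset, card_map]
        intro x hx
        simpa using hπ' x hx
      rw [← h1, ← h2]
      refine card_bij' (fun x _ => ⟨x.1 * Equiv.swap a x.2, x.2⟩)
        (fun x _ => ⟨x.1 * Equiv.swap a x.2, x.2⟩) ?_ ?_ ?_ ?_
      · rintro ⟨π, b⟩ h
        simp only [mem_sigma, mem_compl, hA, hA', mem_filter, mem_univ, true_and,
          forall_mem_insert] at h ⊢
        refine ⟨fun x hx => ?_, h.2, ?_⟩
        · rw [Equiv.Perm.mul_apply, Equiv.swap_apply_of_ne_of_ne]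
          · exact h.1.2 x hx
          · rintro rfl; exact ha hx
          · rintro rfl; exact h.2 hx
        · simpa using h.1.1
      · rintro ⟨π, b⟩ h
        simp only [mem_sigma, mem_compl, hA, hA', mem_filter, mem_univ, true_and,
          forall_mem_insert] at h ⊢
        refine ⟨⟨?_, fun x hx => ?_⟩, h.2.1⟩
        · simpa using h.2.2
        · rw [Equiv.Perm.mul_apply, Equiv.swap_apply_of_ne_of_ne]
          · exact h.1 x hx
          · rintro rfl; exact ha hx
          · rintro rfl; exact h.2.1 hx
      · rintro ⟨π, b⟩ h; simp [mul_assoc]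
      · rintro ⟨π, b⟩ h; simp [mul_assoc]
    have hS : #S < Fintype.card α := by
      rw [← card_univ]; exact card_lt_card ⟨subset_univ _, fun h => ha (h (mem_univ a))⟩
    have hT : #T ≤ Fintype.card α := card_le_univ T
    have hstep : #A * Fintype.card α ≤ #A' * #T := by
      have hpos : 0 < Fintype.card α - #S := by omega
      refine Nat.le_of_mul_le_mul_left ?_ hpos
      calc (Fintype.card α - #S) * (#A * Fintype.card α)
          = (#A * (Fintype.card α - #S)) * Fintype.card α := by ring
        _ = #A' * ((#T - #S) * Fintype.card α) := by rw [hcount]; ring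
        _ ≤ #A' * (#T * (Fintype.card α - #S)) := by
            refine Nat.mul_le_mul_left _ ?_
            rw [Nat.sub_mul, Nat.mul_sub]
            have := Nat.mul_le_mul_left #S hT
            have h3 : #T * #S = #S * #T := mul_comm _ _
            omega
        _ = _ := by ring
    rw [card_insert_of_notMem ha]
    calc #A * Fintype.card α ^ (#S + 1) = (#A * Fintype.card α) * Fintype.card α ^ #S := by ring
      _ ≤ (#A' * #T) * Fintype.card α ^ #S := Nat.mul_le_mul_right _ hstep
      _ = #T * (#A' * Fintype.card α ^ #S) := by ring
      _ ≤ #T * (#T ^ #S * (Fintype.card α).factorial) := Nat.mul_le_mul_left _ ih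
      _ = _ := by ring

lemma choose_mul_pow_self_le (M j : ℕ) : (M.choose j : ℝ) * (j : ℝ) ^ j ≤ 3 ^ j * (M : ℝ) ^ j := by
  have h1 : (M.choose j : ℝ) ≤ (M : ℝ) ^ j / j.factorial := Nat.choose_le_pow_div j M
  have h2 : (j : ℝ) ^ j / j.factorial ≤ Real.exp j :=
    Real.pow_div_factorial_le_exp j (by positivity) j
  have h3 : Real.exp j ≤ 3 ^ j := by
    rw [← Real.exp_one_pow]
    exact pow_le_pow_left₀ (by positivity) (by linarith [Real.exp_one_lt_d9]) j
  have hf : (0 : ℝ) < j.factorial := by positivity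
  calc (M.choose j : ℝ) * (j : ℝ) ^ j ≤ (M : ℝ) ^ j / j.factorial * (j : ℝ) ^ j := by gcongr
    _ = (j : ℝ) ^ j / j.factorial * (M : ℝ) ^ j := by ring
    _ ≤ 3 ^ j * (M : ℝ) ^ j := by gcongr; exact h2.trans h3

lemma small_pair_weight_le {M s : ℕ} (hs : 0 < s) (hM : 16 * s ≤ M) :
    (M.choose s : ℝ) * M.choose (4 * s) * ((4 * s : ℕ) / M : ℝ) ^ (s * 768) ≤ (1 / 4) ^ s := by
  have hM0 : (0 : ℝ) < M := by exact_mod_cast (by omega : 0 < M)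
  have hs0 : (0 : ℝ) < s := by exact_mod_cast hs
  set x : ℝ := (4 * s : ℕ) / M with hx
  have hx0 : 0 < x := by positivity
  have hx1 : x ≤ 1 / 4 := by
    rw [hx, div_le_iff₀ hM0]
    have : ((16 * s : ℕ) : ℝ) ≤ M := by exact_mod_cast hM
    push_cast at this ⊢; linarith
  have h1 : (M.choose s : ℝ) ≤ (12 / x) ^ s := by
    have := choose_mul_pow_self_le M s
    have h : (12 / x : ℝ) ^ s = 3 ^ s * (M : ℝ) ^ s / (s : ℝ) ^ s := by
      rw [← mul_pow, ← div_pow]; congr 1; rw [hx]; push_cast; field_simp; norm_num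
    rw [h, le_div_iff₀ (by positivity)]; exact this
  have h2 : (M.choose (4 * s) : ℝ) ≤ ((3 / x) ^ 4) ^ s := by
    have := choose_mul_pow_self_le M (4 * s)
    have h : ((3 / x : ℝ) ^ 4) ^ s = 3 ^ (4 * s) * (M : ℝ) ^ (4 * s) / ((4 * s : ℕ) : ℝ) ^ (4 * s) := by
      rw [← pow_mul, ← mul_pow, ← div_pow]; congr 1; rw [hx]; field_simp
    rw [h, le_div_iff₀ (by positivity)]; exact this
  have h3 : (12 / x) * (3 / x) ^ 4 * x ^ 768 ≤ 1 / 4 := by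
    have : (12 / x) * (3 / x) ^ 4 * x ^ 768 = 972 * x ^ 763 := by
      field_simp; norm_num
    rw [this]
    have h4 : x ^ 763 ≤ (1 / 4) ^ 6 := by
      calc x ^ 763 ≤ x ^ 6 := pow_le_pow_of_le_one hx0.le (by linarith) (by norm_num)
        _ ≤ _ := pow_le_pow_left₀ hx0.le hx1 6
    calc 972 * x ^ 763 ≤ 972 * (1 / 4) ^ 6 := by gcongr
      _ ≤ 1 / 4 := by norm_num
  calc (M.choose s : ℝ) * M.choose (4 * s) * x ^ (s * 768)
      ≤ (12 / x) ^ s * ((3 / x) ^ 4) ^ s * x ^ (s * 768) := by gcongr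
    _ = ((12 / x) * (3 / x) ^ 4 * x ^ 768) ^ s := by
        rw [mul_comm s 768, pow_mul, mul_pow, mul_pow]
    _ ≤ _ := pow_le_pow_left₀ (by positivity) h3 s

open Classical in
lemma exists_expander : ∃ D : ℕ, ∀ M : ℕ, ∃ Γ : Fin M → Fin M → Prop,
    (∀ a b, Γ a b → Γ b a) ∧ (∀ a, #{b | Γ a b} ≤ D) ∧
    (∀ S : Finset (Fin M), 16 * #S ≤ M → 4 * #S ≤ #{b | ∃ a ∈ S, Γ a b}) ∧
    (∀ S T : Finset (Fin M), 0 < M → M ≤ 16 * #S → M ≤ 16 * #T → ∃ a ∈ S, ∃ b ∈ T, Γ a b) := by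
  obtain ⟨N, hN⟩ : ∃ N : ℕ, N = 768 := ⟨_, rfl⟩
  refine ⟨2 * N, fun M => ?_⟩
  rcases Nat.eq_zero_or_pos M with rfl | hM
  · exact ⟨fun _ _ => True, by simp, fun a => a.elim0, fun S _ => by simp [Finset.eq_empty_of_isEmpty],
      by simp⟩
  have hM0 : (0 : ℝ) < M := by exact_mod_cast hM
  set small : Finset (Finset (Fin M) × Finset (Fin M)) :=
    {ST | 0 < #ST.1 ∧ 16 * #ST.1 ≤ M ∧ #ST.2 = 4 * #ST.1} with hsmall
  set large : Finset (Finset (Fin M) × Finset (Fin M)) :=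
    {ST | M ≤ 16 * #ST.1 ∧ 16 * #ST.2 ≤ 15 * M} with hlarge
  set ev : Finset (Fin M) × Finset (Fin M) → Finset (Fin N → Equiv.Perm (Fin M)) :=
    fun ST => Fintype.piFinset fun _ => {π : Equiv.Perm (Fin M) | ∀ a ∈ ST.1, π a ∈ ST.2} with hev
  have hevcard : ∀ ST, (#(ev ST) : ℝ) ≤
      (#ST.2 / M : ℝ) ^ (#ST.1 * N) * (M.factorial : ℝ) ^ N := by
    intro ST
    have h : #{π : Equiv.Perm (Fin M) | ∀ a ∈ ST.1, π a ∈ ST.2} * M ^ #ST.1 ≤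
        #ST.2 ^ #ST.1 * M.factorial := by
      have := card_perm_mapsTo_mul_le ST.1 ST.2
      rw [Fintype.card_fin] at this
      convert this
    have h' : (#{π : Equiv.Perm (Fin M) | ∀ a ∈ ST.1, π a ∈ ST.2} : ℝ) ≤
        (#ST.2 / M : ℝ) ^ #ST.1 * M.factorial := by
      rw [div_pow, div_mul_eq_mul_div, le_div_iff₀ (by positivity)]
      exact_mod_cast h
    rw [hev, Fintype.card_piFinset]
    simp only [prod_const, card_univ, Fintype.card_fin]
    push_cast
    rw [pow_mul, ← mul_pow]
    exact pow_le_pow_left₀ (by positivity) h' N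
  have hsmallsum : ∑ ST ∈ small, (#ST.2 / M : ℝ) ^ (#ST.1 * N) ≤ 1 / 3 := by
    have hfib : ∑ ST ∈ small, (#ST.2 / M : ℝ) ^ (#ST.1 * N) =
        ∑ s ∈ Ico 1 (M + 1), ∑ ST ∈ small with #ST.1 = s, (#ST.2 / M : ℝ) ^ (#ST.1 * N) := by
      refine (sum_fiberwise_of_maps_to ?_ _).symm
      intro ST h
      simp only [hsmall, mem_filter, mem_univ, true_and] at h
      simp only [mem_Ico]; omega
    rw [hfib]
    calc _ ≤ ∑ s ∈ Ico 1 (M + 1), (1 / 4 : ℝ) ^ s := by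
          refine sum_le_sum fun s hs => ?_
          rw [mem_Ico] at hs
          by_cases h16 : 16 * s ≤ M
          · have hsub : ({ST ∈ small | #ST.1 = s} : Finset _) ⊆
                powersetCard s univ ×ˢ powersetCard (4 * s) univ := by
              intro ST h
              simp only [hsmall, mem_filter, mem_univ, true_and] at h
              simp only [mem_product, mem_powersetCard, subset_univ, true_and]
              omega
            calc _ = ∑ ST ∈ small with #ST.1 = s, ((4 * s : ℕ) / M : ℝ) ^ (s * N) := by
                  refine sum_congr rfl fun ST h => ?_
                  simp only [hsmall, mem_filter, mem_univ, true_and] at h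
                  rw [h.1.2.2, h.2]
              _ ≤ ∑ ST ∈ (powersetCard s (univ : Finset (Fin M))) ×ˢ
                    (powersetCard (4 * s) (univ : Finset (Fin M))),
                    ((4 * s : ℕ) / M : ℝ) ^ (s * N) :=
                  sum_le_sum_of_subset_of_nonneg hsub fun _ _ _ => by positivity
              _ = (M.choose s : ℝ) * M.choose (4 * s) * ((4 * s : ℕ) / M : ℝ) ^ (s * N) := by
                  rw [sum_const, card_product, card_powersetCard, card_powersetCard, nsmul_eq_mul]
                  simp only [card_univ, Fintype.card_fin]
                  push_cast
                  rfl
              _ ≤ _ := hN ▸ small_pair_weight_le (by omega) h16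
          · rw [sum_eq_zero]
            · positivity
            · intro ST h
              simp only [hsmall, mem_filter, mem_univ, true_and] at h
              omega
      _ ≤ 1 / 3 := by
          rw [geom_sum_Ico (by norm_num) (by omega)]
          have : (0 : ℝ) ≤ (1 / 4) ^ (M + 1) := by positivity
          rw [div_le_iff_of_neg (by norm_num)]
          norm_num
  have hlargesum : ∑ ST ∈ large, (#ST.2 / M : ℝ) ^ (#ST.1 * N) ≤ 1 / 4 := by
    calc _ ≤ ∑ ST ∈ large, ((15 / 16 : ℝ) ^ 48) ^ M := by
          refine sum_le_sum fun ST h => ?_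
          simp only [hlarge, mem_filter, mem_univ, true_and] at h
          have h1 : (#ST.2 / M : ℝ) ≤ 15 / 16 := by
            rw [div_le_iff₀ hM0]
            have : ((16 * #ST.2 : ℕ) : ℝ) ≤ ((15 * M : ℕ) : ℝ) := by exact_mod_cast h.2
            push_cast at this; linarith
          calc (#ST.2 / M : ℝ) ^ (#ST.1 * N) ≤ (15 / 16) ^ (#ST.1 * N) :=
                pow_le_pow_left₀ (by positivity) h1 _
            _ ≤ (15 / 16) ^ (48 * M) :=
                pow_le_pow_of_le_one (by norm_num) (by norm_num) (by subst hN; omega)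
            _ = _ := by rw [pow_mul]
      _ ≤ ∑ ST : Finset (Fin M) × Finset (Fin M), ((15 / 16 : ℝ) ^ 48) ^ M :=
          sum_le_sum_of_subset_of_nonneg (subset_univ _) fun _ _ _ => by positivity
      _ = (4 * (15 / 16 : ℝ) ^ 48) ^ M := by
          rw [sum_const, card_univ, Fintype.card_prod, Fintype.card_finset, Fintype.card_fin,
            nsmul_eq_mul, mul_pow]
          push_cast
          rw [← mul_pow]; norm_num
      _ ≤ (1 / 4) ^ M := pow_le_pow_left₀ (by positivity) (by norm_num) M
      _ ≤ (1 / 4) ^ 1 := pow_le_pow_of_le_one (by norm_num) (by norm_num) hM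
      _ = 1 / 4 := by norm_num
  have hex : ∃ π : Fin N → Equiv.Perm (Fin M), ∀ ST ∈ small ∪ large, π ∉ ev ST := by
    by_contra! hcon
    have hcover : (univ : Finset (Fin N → Equiv.Perm (Fin M))) ⊆ (small ∪ large).biUnion ev := by
      intro π _
      obtain ⟨ST, h1, h2⟩ := hcon π
      exact mem_biUnion.2 ⟨ST, h1, h2⟩
    have h1 : ((M.factorial : ℝ)) ^ N ≤ ∑ ST ∈ small ∪ large, (#(ev ST) : ℝ) := by
      have := (card_le_card hcover).trans card_biUnion_le
      rw [card_univ, Fintype.card_fun, Fintype.card_perm, Fintype.card_fin, Fintype.card_fin] at this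
      exact_mod_cast this
    have h2 : ∑ ST ∈ small ∪ large, (#(ev ST) : ℝ) ≤ (1 / 3 + 1 / 4) * (M.factorial : ℝ) ^ N := by
      calc _ ≤ ∑ ST ∈ small, (#(ev ST) : ℝ) + ∑ ST ∈ large, (#(ev ST) : ℝ) := by
            rw [← sum_union_inter]
            have : 0 ≤ ∑ ST ∈ small ∩ large, (#(ev ST) : ℝ) := sum_nonneg fun _ _ => by positivity
            linarith
        _ ≤ ∑ ST ∈ small, (#ST.2 / M : ℝ) ^ (#ST.1 * N) * (M.factorial : ℝ) ^ N +
            ∑ ST ∈ large, (#ST.2 / M : ℝ) ^ (#ST.1 * N) * (M.factorial : ℝ) ^ N :=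
            add_le_add (sum_le_sum fun ST _ => hevcard ST) (sum_le_sum fun ST _ => hevcard ST)
        _ ≤ _ := by
            rw [← sum_mul, ← sum_mul, ← add_mul]
            gcongr
    have hpos : (0 : ℝ) < (M.factorial : ℝ) ^ N := by positivity
    generalize (M.factorial : ℝ) ^ N = F at h1 h2 hpos
    linarith
  obtain ⟨π, hπ⟩ := hex
  refine ⟨fun a b => ∃ i, π i a = b ∨ π i b = a, ?_, ?_, ?_, ?_⟩
  · rintro a b ⟨i, h | h⟩
    exacts [⟨i, Or.inr h⟩, ⟨i, Or.inl h⟩]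
  · intro a
    refine (card_le_card (t := univ.image (fun i => π i a) ∪ univ.image (fun i => (π i).symm a))
      ?_).trans ((card_union_le _ _).trans ?_)
    · intro b hb
      simp only [mem_filter, mem_univ, true_and, mem_union, mem_image] at hb ⊢
      obtain ⟨i, h | h⟩ := hb
      · exact Or.inl ⟨i, h⟩
      · exact Or.inr ⟨i, by simp [← h]⟩
    have h1 := card_image_le (s := (univ : Finset (Fin N))) (f := fun i => π i a)
    have h2 := card_image_le (s := (univ : Finset (Fin N))) (f := fun i => (π i).symm a)
    simp only [card_univ, Fintype.card_fin] at h1 h2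
    omega
  · intro S hS
    rcases S.eq_empty_or_nonempty with rfl | hne
    · simp
    by_contra! hlt
    obtain ⟨T, hT1, hT2⟩ := exists_superset_card_eq (n := 4 * #S) hlt.le
      (by rw [Fintype.card_fin]; omega)
    refine hπ (S, T) (mem_union_left _ ?_) ?_
    · simp [hsmall, hT2, hS, hne]
    · simp only [hev, Fintype.mem_piFinset, mem_filter, mem_univ, true_and]
      intro i a ha
      exact hT1 (by simpa using ⟨a, ha, i, Or.inl rfl⟩)
  · intro S T _ hS hT
    by_contra! hcon
    refine hπ (S, Tᶜ) (mem_union_right _ ?_) ?_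
    · simp only [hlarge, mem_filter, mem_univ, true_and, card_compl, Fintype.card_fin]
      omega
    · simp only [hev, Fintype.mem_piFinset, mem_filter, mem_univ, true_and, mem_compl]
      intro i a ha hT
      exact hcon a ha _ hT i |>.1 rfl

end Expander

section Template

lemma exists_injOn_fin {V : Type*} (M : ℕ) (hM : 0 < M) (Z W : Finset V) (hd : Disjoint Z W)
    (hZ : #Z = M) (hW : #W = M) :
    ∃ ψ : V → Fin M, Set.InjOn ψ Z ∧ Set.InjOn ψ W := by
  classical
  let eZ := Z.equivFinOfCardEq hZ
  let eW := W.equivFinOfCardEq hW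
  refine ⟨fun x => if h : x ∈ Z then eZ ⟨x, h⟩ else if h : x ∈ W then eW ⟨x, h⟩ else ⟨0, hM⟩,
    ?_, ?_⟩
  · intro x hx y hy h
    rw [mem_coe] at hx hy
    simpa [hx, hy] using h
  · intro x hx y hy h
    rw [mem_coe] at hx hy
    have hx' := disjoint_right.1 hd hx
    have hy' := disjoint_right.1 hd hy
    simpa [hx, hy, hx', hy'] using h

lemma exists_template : ∃ D : ℕ, ∀ (V : Type) [DecidableEq V] (r : ℕ) (Z W : Finset V),
    Disjoint Z W → #Z = 3 * r → #W = 3 * r →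
    ∃ cand : Fin (4 * r) → Finset V, (∀ y, cand y ⊆ Z ∪ W) ∧ (∀ y, #(cand y) ≤ D) ∧
      (∀ x, #{y | x ∈ cand y} ≤ D) ∧
      ∀ R ⊆ W, r ≤ #R → ∃ c : Fin (4 * r) → V, Function.Injective c ∧
        ∀ y, c y ∈ cand y ∧ c y ∈ Z ∪ R := by
  classical
  obtain ⟨D, hD⟩ := exists_expander
  refine ⟨2 * D, fun V _ r Z W hd hZ hW => ?_⟩
  rcases Nat.eq_zero_or_pos r with rfl | hr
  · exact ⟨fun _ => ∅, by simp, by simp, by simp, fun R _ _ => ⟨fun y => y.elim0,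
      fun y => y.elim0, fun y => y.elim0⟩⟩
  obtain ⟨Γ, hsymm, hdeg, hE1, hE2⟩ := hD (3 * r)
  obtain ⟨ψ, hψZ, hψW⟩ := exists_injOn_fin (3 * r) (by omega) Z W hd hZ hW
  let φ : Fin (4 * r) → Fin (3 * r) := fun y => ⟨y % (3 * r), Nat.mod_lt _ (by omega)⟩
  have hφsurj : Function.Surjective φ := fun a =>
    ⟨⟨a, by have := a.2; omega⟩, Fin.ext (Nat.mod_eq_of_lt a.2)⟩
  have hφ2 : ∀ a, #{y | φ y = a} ≤ 2 := by
    intro a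
    have : ({y | φ y = a} : Finset (Fin (4 * r))).map Fin.valEmbedding ⊆
        {(a : ℕ), (a : ℕ) + 3 * r} := by
      intro y hy
      simp only [mem_map, mem_filter, mem_univ, true_and] at hy
      obtain ⟨y, hy, rfl⟩ := hy
      have h1 : (y : ℕ) % (3 * r) = a := congrArg Fin.val hy
      have h2 := Nat.mod_add_div (y : ℕ) (3 * r)
      have h3 : (y : ℕ) / (3 * r) < 2 := by
        rw [Nat.div_lt_iff_lt_mul (by omega)]; have := y.2; omega
      simp only [Fin.valEmbedding_apply, mem_insert, mem_singleton]
      interval_cases hq : (y : ℕ) / (3 * r) <;> omega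
    have h := (card_le_card this).trans card_le_two
    rwa [card_map] at h
  have hψ2 : ∀ a (X : Finset V), X ⊆ Z ∪ W → #{x ∈ X | ψ x = a} ≤ 2 := by
    intro a X hX
    have h1 : #{x ∈ Z | ψ x = a} ≤ 1 := by
      refine card_le_one.2 fun x hx y hy => ?_
      rw [mem_filter] at hx hy
      exact hψZ hx.1 hy.1 (hx.2.trans hy.2.symm)
    have h2 : #{x ∈ W | ψ x = a} ≤ 1 := by
      refine card_le_one.2 fun x hx y hy => ?_
      rw [mem_filter] at hx hy
      exact hψW hx.1 hy.1 (hx.2.trans hy.2.symm)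
    have h3 : #{x ∈ X | ψ x = a} ≤ #({x ∈ Z | ψ x = a} ∪ {x ∈ W | ψ x = a}) := by
      rw [← filter_union]; exact card_le_card (filter_subset_filter _ hX)
    have := card_union_le ({x ∈ Z | ψ x = a}) ({x ∈ W | ψ x = a})
    omega
  have hψle : ∀ (X : Finset V) (B : Finset (Fin (3 * r))), X ⊆ Z ∪ W → (∀ x ∈ X, ψ x ∈ B) →
      #X ≤ 2 * #B := by
    intro X B hX hB
    exact card_le_mul_card_image_of_maps_to hB 2 fun a _ => hψ2 a X hX
  have hφle : ∀ (S : Finset (Fin (4 * r))) (B : Finset (Fin (3 * r))), (∀ x ∈ S, φ x ∈ B) →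
      #S ≤ 2 * #B := by
    intro S B hB
    exact card_le_mul_card_image_of_maps_to hB 2 fun a _ =>
      (card_le_card (filter_subset_filter _ (subset_univ _))).trans (hφ2 a)
  refine ⟨fun y => {x ∈ Z ∪ W | Γ (φ y) (ψ x)}, fun y => filter_subset _ _, fun y => ?_,
    fun x => ?_, fun R hR hRr => ?_⟩
  · refine (hψle _ {b | Γ (φ y) b} (filter_subset _ _) fun x hx => ?_).trans
      (Nat.mul_le_mul_left 2 (hdeg _))
    simpa using (mem_filter.1 hx).2
  · refine (hφle _ {b | Γ (ψ x) b} fun y hy => ?_).trans (Nat.mul_le_mul_left 2 (hdeg _))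
    simp only [mem_filter, mem_univ, true_and] at hy ⊢
    exact hsymm _ _ hy.2
  · have hZR : Z ∪ R ⊆ Z ∪ W := union_subset_union_right hR
    have key : ∀ S : Finset (Fin (4 * r)),
        #S ≤ #(S.biUnion fun y => {x ∈ Z ∪ R | Γ (φ y) (ψ x)}) := by
      intro S
      set N := S.biUnion fun y => {x ∈ Z ∪ R | Γ (φ y) (ψ x)} with hN
      have hψsurj : ∀ b, ∃ z ∈ Z, ψ z = b := by
        have : Z.image ψ = univ := by
          rw [← card_eq_iff_eq_univ, card_image_of_injOn hψZ, hZ, Fintype.card_fin]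
        intro b
        have hb := mem_univ b
        rw [← this, mem_image] at hb
        exact hb
      by_cases hsmall : 16 * #(S.image φ) ≤ 3 * r
      · have h1 := hE1 _ hsmall
        have h2 : #{b | ∃ a ∈ S.image φ, Γ a b} ≤ #N := by
          refine (card_le_card (t := N.image ψ) ?_).trans card_image_le
          intro b hb
          simp only [mem_filter, mem_univ, true_and, mem_image] at hb
          obtain ⟨_, ⟨y, hy, rfl⟩, hyb⟩ := hb
          obtain ⟨z, hz, rfl⟩ := hψsurj b
          exact mem_image_of_mem _ (mem_biUnion.2 ⟨y, hy, mem_filter.2 ⟨mem_union_left _ hz, hyb⟩⟩)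
        have h3 := hφle S (S.image φ) fun y hy => mem_image_of_mem _ hy
        omega
      · set B : Finset (Fin (3 * r)) := {b | ∀ a ∈ S.image φ, ¬ Γ a b} with hB
        have hBs : 16 * #B ≤ 3 * r := by
          by_contra hlt
          obtain ⟨a, ha, b, hb, hab⟩ := hE2 (S.image φ) B (by omega) (by omega) (by omega)
          simp only [hB, mem_filter, mem_univ, true_and] at hb
          exact hb a ha hab
        have h1 := hE1 B hBs
        have h2 : #{b | ∃ a ∈ B, Γ a b} ≤ #Sᶜ := by
          refine (card_le_card (t := Sᶜ.image φ) ?_).trans card_image_le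
          intro b hb
          simp only [mem_filter, mem_univ, true_and] at hb
          obtain ⟨a, ha, hab⟩ := hb
          obtain ⟨y, rfl⟩ := hφsurj b
          refine mem_image_of_mem _ (mem_compl.2 fun hy => ?_)
          simp only [hB, mem_filter, mem_univ, true_and] at ha
          exact ha _ (mem_image_of_mem _ hy) (hsymm _ _ hab)
        have h3 : #((Z ∪ R) \ N) ≤ 2 * #B := by
          refine hψle _ _ (sdiff_subset.trans hZR) fun x hx => ?_
          rw [mem_sdiff] at hx
          simp only [hB, mem_filter, mem_univ, true_and, forall_mem_image]
          intro y hy hyx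
          exact hx.2 (mem_biUnion.2 ⟨y, hy, mem_filter.2 ⟨hx.1, hyx⟩⟩)
        have h4 : #(Z ∪ R) = #Z + #R := card_union_of_disjoint (disjoint_of_subset_right hR hd)
        have h5 : #(Z ∪ R) ≤ #((Z ∪ R) \ N) + #N := card_le_card_sdiff_add_card
        have h6 := card_compl S
        rw [Fintype.card_fin] at h6
        have h7 : #S ≤ 4 * r := by simpa using card_le_univ S
        omega
    obtain ⟨c, hc, hcm⟩ := (all_card_le_biUnion_card_iff_exists_injective _).1 key
    refine ⟨c, hc, fun y => ?_⟩
    have := mem_filter.1 (hcm y)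
    exact ⟨mem_filter.2 ⟨hZR this.1, this.2⟩, this.1⟩

end Template

section Embedding

variable {V : Type}

/-- The number of neighbours of `v` in `X`. -/
def degIn (G : SimpleGraph V) [DecidableRel G.Adj] (X : Finset V) (v : V) : ℕ :=
  #{u ∈ X | G.Adj v u}

variable {G : SimpleGraph V} [DecidableRel G.Adj] {s d β e₀ Q : ℕ}

lemma degIn_mono {X Y : Finset V} (hXY : X ⊆ Y) (v : V) : degIn G X v ≤ degIn G Y v :=
  card_le_card (filter_subset_filter _ hXY)

lemma degIn_le_degIn_sdiff_add [DecidableEq V] (X Y : Finset V) (v : V) :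
    degIn G X v ≤ degIn G (X \ Y) v + #(Y ∩ X) := by
  have h1 : ({u ∈ X | G.Adj v u} : Finset V) ⊆ {u ∈ X \ Y | G.Adj v u} ∪ (Y ∩ X) := by
    intro u hu
    rw [mem_filter] at hu
    by_cases huY : u ∈ Y <;> simp [hu, huY]
  exact (card_le_card h1).trans (card_union_le _ _)

lemma card_nbrs_sdiff [DecidableEq V] {X T : Finset V} {x : V} (hx : d ≤ degIn G X x) :
    d - #T ≤ #({u ∈ X | G.Adj x u} \ T) := by
  have := le_card_sdiff T {u ∈ X | G.Adj x u}
  unfold degIn at hx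
  omega

variable [Fintype V]

/-- At most `β` vertices have degree less than `d` into any given set of at least `s` vertices, and
there is an edge between any two sets of at least `e₀` vertices. -/
structure IsSpread (G : SimpleGraph V) [DecidableRel G.Adj] (s d β e₀ : ℕ) : Prop where
  few_bad : ∀ X : Finset V, s ≤ #X → #{v | degIn G X v < d} ≤ β
  edge : ∀ A B : Finset V, e₀ ≤ #A → e₀ ≤ #B → ∃ a ∈ A, ∃ b ∈ B, G.Adj a b

lemma IsSpread.card_good (h : IsSpread G s d β e₀) {X A : Finset V} (hX : s ≤ #X) :
    #A - β ≤ #{a ∈ A | d ≤ degIn G X a} := by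
  have h1 := h.few_bad X hX
  have h2 : #{a ∈ A | ¬ d ≤ degIn G X a} ≤ #{v | degIn G X v < d} := by
    refine card_le_card fun a ha => ?_
    simpa using (mem_filter.1 ha).2
  have h3 := card_filter_add_card_filter_not (s := A) fun a => d ≤ degIn G X a
  omega

lemma IsSpread.exists_good (h : IsSpread G s d β e₀) {X A : Finset V} (hX : s ≤ #X)
    (hA : β < #A) : ∃ a ∈ A, d ≤ degIn G X a := by
  have h1 := h.card_good (A := A) hX
  obtain ⟨a, ha⟩ : ({a ∈ A | d ≤ degIn G X a}).Nonempty := card_pos.1 (by omega)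
  exact ⟨a, mem_filter.1 ha⟩

variable [DecidableEq V]

lemma IsSpread.exists_link (h : IsSpread G s d β e₀) (hQ : e₀ + β + Q ≤ d) {X : Finset V}
    (hX : s ≤ #X) {q : ℕ} (hq : 2 ≤ q) {y : V} (hy : d ≤ degIn G X y) (T : Finset V) (x : V)
    (hT : #T + q ≤ Q) (hx : d ≤ degIn G X x) :
    ∃ l : List V, l.length = q ∧ l.Nodup ∧ (∀ v ∈ l, v ∈ X ∧ v ∉ T) ∧
      (x :: l ++ [y]).IsChain G.Adj := by
  induction q, hq using Nat.le_induction generalizing T x with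
  | base =>
    have hA := card_nbrs_sdiff (T := T) hx
    have hB := card_nbrs_sdiff (T := T) hy
    obtain ⟨a, ha, b, hb, hab⟩ := h.edge _ _ (by omega : e₀ ≤ #({u ∈ X | G.Adj x u} \ T))
      (by omega : e₀ ≤ #({u ∈ X | G.Adj y u} \ T))
    simp only [mem_sdiff, mem_filter] at ha hb
    refine ⟨[a, b], rfl, ?_, ?_, ?_⟩
    · simpa using hab.ne
    · simp [ha, hb]
    · simp [ha.1.2, hab, hb.1.2.symm]
  | succ q hq ih =>
    have hA := card_nbrs_sdiff (T := T) hx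
    obtain ⟨a, ha, hda⟩ := h.exists_good hX (by omega : β < #({u ∈ X | G.Adj x u} \ T))
    simp only [mem_sdiff, mem_filter] at ha
    obtain ⟨l, hl, hnd, hmem, hc⟩ := ih (insert a T) a
      (by have := card_insert_le a T; omega) hda
    refine ⟨a :: l, by simp [hl], ?_, ?_, ?_⟩
    · refine List.nodup_cons.2 ⟨fun hal => ?_, hnd⟩
      exact (hmem a hal).2 (mem_insert_self _ _)
    · intro v hv
      rcases List.mem_cons.1 hv with rfl | hv
      · exact ⟨ha.1.1, ha.2⟩
      · exact ⟨(hmem v hv).1, fun hvT => (hmem v hv).2 (mem_insert_of_mem hvT)⟩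
    · simp only [List.cons_append, List.isChain_cons_cons] at hc ⊢
      exact ⟨ha.1.2, hc⟩

lemma IsSpread.exists_path (h : IsSpread G s d β e₀) {X : Finset V} (hX : s ≤ #X) (hβ : β < #X)
    (f : ℕ) (hf : β + f + 1 ≤ d) : ∃ x : V, ∃ l : List V, d ≤ degIn G X x ∧ l.length = f ∧
      (x :: l).Nodup ∧ (∀ v ∈ x :: l, v ∈ X) ∧ (x :: l).IsChain G.Adj := by
  induction f with
  | zero =>
    obtain ⟨a, ha, hda⟩ := h.exists_good hX hβ
    exact ⟨a, [], hda, rfl, by simp, by simpa using ha, by simp⟩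
  | succ f ih =>
    obtain ⟨x, l, hx, hl, hnd, hmem, hc⟩ := ih (by omega)
    have hA := card_nbrs_sdiff (T := (x :: l).toFinset) hx
    have hcard : #(x :: l).toFinset ≤ f + 1 := by
      simpa [hl] using List.toFinset_card_le (x :: l)
    obtain ⟨a, ha, hda⟩ := h.exists_good hX
      (by omega : β < #({u ∈ X | G.Adj x u} \ (x :: l).toFinset))
    rw [mem_sdiff, mem_filter, List.mem_toFinset] at ha
    refine ⟨a, x :: l, hda, by simp [hl], List.nodup_cons.2 ⟨ha.2, hnd⟩, ?_, ?_⟩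
    · intro v hv
      rcases List.mem_cons.1 hv with rfl | hv
      exacts [ha.1.1, hmem v hv]
    · exact List.isChain_cons_cons.2 ⟨ha.1.2.symm, hc⟩

/-- For every sublist `ys` of `xs` there is a path from `a` to `b` whose vertices are
those of `S` and `ys`. -/
def IsAbsorber (G : SimpleGraph V) (xs : List V) (a b : V) (S : Finset V) : Prop :=
  ∀ ys : List V, ys.Sublist xs → ∃ l : List V, l.IsChain G.Adj ∧ l.head? = some a ∧
    l.getLast? = some b ∧ (l : Multiset V) = S.val + ys

lemma IsSpread.exists_absorber (h : IsSpread G s d β e₀) (hQ : e₀ + β + Q ≤ d) {X : Finset V}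
    (hX : s ≤ #X) (hβ : β < #X) (xs : List V) (hxs : ∀ x ∈ xs, d ≤ degIn G X x)
    (hlen : 4 * xs.length + 1 ≤ Q) :
    ∃ S ⊆ X, #S = 4 * xs.length + 1 ∧ ∃ a ∈ S, ∃ b ∈ S, d ≤ degIn G X a ∧ IsAbsorber G xs a b S := by
  induction xs with
  | nil =>
    obtain ⟨a, ha, hda⟩ := h.exists_good hX hβ
    refine ⟨{a}, by simpa using ha, by simp, a, by simp, a, by simp, hda, ?_⟩
    intro ys hys
    rw [List.sublist_nil] at hys
    exact ⟨[a], by simp [hys]⟩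
  | cons x xs ih =>
    simp only [List.length_cons] at hlen
    obtain ⟨S, hSX, hS, a', ha'S, e, heS, hda', habs⟩ :=
      ih (fun y hy => hxs y (List.mem_cons_of_mem _ hy)) (by omega)
    have hA := card_nbrs_sdiff (T := S) (hxs x List.mem_cons_self)
    have hA' := h.card_good (A := {u ∈ X | G.Adj x u} \ S) hX
    obtain ⟨a, ha, b, hb, hab⟩ := h.edge
      {a ∈ {u ∈ X | G.Adj x u} \ S | d ≤ degIn G X a}
      {a ∈ {u ∈ X | G.Adj x u} \ S | d ≤ degIn G X a} (by omega) (by omega)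
    simp only [mem_sdiff, mem_filter] at ha hb
    have hT : #(insert a (insert b S)) ≤ 4 * xs.length + 3 := by
      have h1 := card_insert_le a (insert b S)
      have h2 := card_insert_le b S
      omega
    obtain ⟨l, hl, hnd, hmem, hc⟩ := h.exists_link hQ hX le_rfl hda' (insert a (insert b S)) b
      (by omega) hb.2
    have hlS : Disjoint l.toFinset S := by
      rw [disjoint_left]
      intro v hv hvS
      exact (hmem v (List.mem_toFinset.1 hv)).2 (by simp [hvS])
    have hbl : b ∉ l.toFinset ∪ S := by
      rw [mem_union, List.mem_toFinset]
      rintro (hbl | hbS)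
      · exact (hmem b hbl).2 (by simp)
      · exact hb.1.2 hbS
    have hal : a ∉ insert b (l.toFinset ∪ S) := by
      rw [mem_insert, mem_union, List.mem_toFinset]
      rintro (hab' | hal | haS)
      · exact hab.ne hab'
      · exact (hmem a hal).2 (by simp)
      · exact ha.1.2 haS
    have hval : (insert a (insert b (l.toFinset ∪ S))).val = (a ::ₘ b ::ₘ (l : Multiset V)) + S.val := by
      rw [insert_val_of_notMem hal, insert_val_of_notMem hbl, ← disjUnion_eq_union _ _ hlS]
      simp only [disjUnion_val, List.toFinset_val, hnd.dedup, Multiset.cons_add]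
    refine ⟨insert a (insert b (l.toFinset ∪ S)), ?_, ?_, a, by simp, e, by simp [heS], ha.2, ?_⟩
    · intro v hv
      simp only [mem_insert, mem_union, List.mem_toFinset] at hv
      rcases hv with rfl | rfl | hv | hv
      exacts [ha.1.1.1, hb.1.1.1, (hmem v hv).1, hSX hv]
    · rw [card_insert_of_notMem hal, card_insert_of_notMem hbl, card_union_of_disjoint hlS,
        List.toFinset_card_of_nodup hnd, hl, hS, List.length_cons]
      ring
    · intro ys hys
      have main : ∀ zs : List V, zs.Sublist xs → ∃ m : List V, (b :: (l ++ m)).IsChain G.Adj ∧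
          m ≠ [] ∧ m.getLast? = some e ∧ (m : Multiset V) = S.val + zs := by
        intro zs hzs
        obtain ⟨m, hmc, hmh, hml, hm⟩ := habs zs hzs
        cases m with
        | nil => simp at hmh
        | cons m₀ m =>
          obtain rfl : m₀ = a' := by simpa using hmh
          exact ⟨m₀ :: m, List.isChain_split.2 ⟨hc, hmc⟩, by simp, hml, hm⟩
      rcases List.sublist_cons_iff.1 hys with hys | ⟨zs, rfl, hzs⟩
      · obtain ⟨m, hmc, hmne, hml, hm⟩ := main ys hys
        refine ⟨a :: b :: (l ++ m), List.isChain_cons_cons.2 ⟨hab, hmc⟩, rfl, ?_, ?_⟩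
        · rw [List.getLast?_cons_cons, List.getLast?_cons, List.getLast?_append, hml]; rfl
        · rw [hval, ← Multiset.cons_coe, ← Multiset.cons_coe, ← Multiset.coe_add, hm]
          simp only [Multiset.cons_add, add_assoc]
      · obtain ⟨m, hmc, hmne, hml, hm⟩ := main zs hzs
        refine ⟨a :: x :: b :: (l ++ m), List.isChain_cons_cons.2 ⟨ha.1.1.2.symm,
          List.isChain_cons_cons.2 ⟨hb.1.1.2, hmc⟩⟩, rfl, ?_, ?_⟩
        · rw [List.getLast?_cons_cons, List.getLast?_cons_cons, List.getLast?_cons,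
            List.getLast?_append, hml]; rfl
        · rw [hval, ← Multiset.cons_coe, ← Multiset.cons_coe, ← Multiset.cons_coe,
            ← Multiset.coe_add, hm, ← Multiset.cons_coe]
          simp only [Multiset.cons_add, Multiset.add_cons, add_assoc]
          rw [Multiset.cons_swap x a]

lemma IsSpread.exists_connection (h : IsSpread G s d β e₀) (hQ : e₀ + β + Q ≤ d) {X : Finset V}
    (hX : s ≤ #X) {b : V} (hb : d ≤ degIn G X b) (ps : List (List V))
    (hps : ∀ p ∈ ps, p ≠ [] ∧ p.IsChain G.Adj ∧ ∀ v ∈ p, d ≤ degIn G X v) (a : V)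
    (ha : d ≤ degIn G X a) (T : Finset V) (q : ℕ) (hq : 2 * (ps.length + 1) ≤ q)
    (hT : #T + q ≤ Q) :
    ∃ S ⊆ X \ T, #S = q ∧ ∃ l : List V, (a :: l ++ [b]).IsChain G.Adj ∧ l ≠ [] ∧
      (l : Multiset V) = S.val + (ps.flatten : Multiset V) := by
  induction ps generalizing a T q with
  | nil =>
    obtain ⟨l, hl, hnd, hmem, hc⟩ := h.exists_link hQ hX (by simpa using hq) hb T a hT ha
    refine ⟨l.toFinset, ?_, by rw [List.toFinset_card_of_nodup hnd, hl], l, hc, ?_, ?_⟩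
    · intro v hv
      rw [mem_sdiff]
      exact hmem v (List.mem_toFinset.1 hv)
    · rintro rfl
      simp at hl hq
      omega
    · simp [hnd.dedup]
  | cons p ps ih =>
    obtain ⟨hne, hpc, hpd⟩ := hps p List.mem_cons_self
    simp only [List.length_cons] at hq
    obtain ⟨x, t, rfl⟩ := List.exists_cons_of_ne_nil hne
    obtain ⟨l, hl, hnd, hmem, hc⟩ := h.exists_link hQ hX le_rfl (hpd x List.mem_cons_self) T a
      (by omega) ha
    obtain ⟨t', z, hz⟩ := List.eq_nil_or_concat' (x :: t) |>.resolve_left hne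
    have hcard : #(l.toFinset ∪ T) ≤ 2 + #T := by
      have h1 := card_union_le l.toFinset T
      have h2 := List.toFinset_card_le l
      omega
    obtain ⟨S, hS, hSc, m, hm, hmne, hmS⟩ := ih (fun p hp => hps p (List.mem_cons_of_mem _ hp)) z
      (hpd z (by rw [hz]; simp)) (l.toFinset ∪ T) (q - 2) (by omega) (by omega)
    have hdis : Disjoint l.toFinset S := by
      rw [disjoint_right]
      intro v hv hvl
      exact (mem_sdiff.1 (hS hv)).2 (mem_union_left _ hvl)
    refine ⟨l.toFinset ∪ S, ?_, ?_, l ++ (x :: t) ++ m, ?_, by simp, ?_⟩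
    · intro v hv
      rcases mem_union.1 hv with hv | hv
      · exact mem_sdiff.2 (hmem v (List.mem_toFinset.1 hv))
      · have := mem_sdiff.1 (hS hv)
        exact mem_sdiff.2 ⟨this.1, fun hvT => this.2 (mem_union_right _ hvT)⟩
    · rw [card_union_of_disjoint hdis, List.toFinset_card_of_nodup hnd, hl, hSc]
      omega
    · have h1 : (a :: l ++ (x :: t)).IsChain G.Adj := List.isChain_split.2 ⟨hc, hpc⟩
      rw [hz, ← List.append_assoc] at h1
      have h2 := List.isChain_split.2 ⟨h1, by simpa using hm⟩
      rw [hz]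
      simpa using h2
    · rw [← disjUnion_eq_union _ _ hdis, List.flatten_cons, ← Multiset.coe_add,
        ← Multiset.coe_add, hmS, ← Multiset.coe_add]
      simp only [disjUnion_val, List.toFinset_val, hnd.dedup]
      abel

end Embedding

section Assembly

variable {V : Type} [Fintype V] [DecidableEq V]

variable {G : SimpleGraph V} [DecidableRel G.Adj] {s d β e₀ Q : ℕ}

lemma IsSpread.exists_path_cover (h : IsSpread G s d β e₀) {f : ℕ} (hf : 0 < f) (hβ : β < s)
    (hfd : β + f ≤ d) (F : Finset V) :
    ∃ P : List (List V), (∀ p ∈ P, p ≠ [] ∧ p.length ≤ f ∧ p.IsChain G.Adj) ∧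
      (P.flatten : Multiset V) = F.val ∧ f * P.length ≤ #F + f * s := by
  induction F using Finset.strongInduction with
  | H F ih =>
    by_cases hF : #F < s
    · refine ⟨F.toList.map ([·]), ?_, ?_, ?_⟩
      · simp only [List.mem_map, forall_exists_index, and_imp]
        rintro p v - rfl
        simp
        omega
      · rw [← List.flatMap_def]
        simp
      · simp only [List.length_map, length_toList]
        nlinarith
    · obtain ⟨x, l, -, hl, hnd, hmem, hc⟩ := h.exists_path (not_lt.1 hF) (by omega) (f - 1)
        (by omega)
      have hsub : (x :: l).toFinset ⊆ F := fun v hv => hmem v (List.mem_toFinset.1 hv)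
      have hcard : #(x :: l).toFinset = f := by
        rw [List.toFinset_card_of_nodup hnd, List.length_cons, hl]
        omega
      obtain ⟨P, hP, hPF, hPc⟩ := ih (F \ (x :: l).toFinset)
        (sdiff_ssubset hsub ⟨x, by simp⟩)
      rw [card_sdiff_of_subset hsub, hcard] at hPc
      have hle := card_le_card hsub
      refine ⟨(x :: l) :: P, ?_, ?_, ?_⟩
      · intro p hp
        rcases List.mem_cons.1 hp with rfl | hp
        · exact ⟨by simp, by simp only [List.length_cons]; omega, hc⟩
        · exact hP p hp
      · rw [List.flatten_cons, ← Multiset.coe_add, hPF, sdiff_val, List.toFinset_val, hnd.dedup]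
        refine add_tsub_cancel_of_le ?_
        have := val_le_iff.2 hsub
        rwa [List.toFinset_val, hnd.dedup] at this
      · rw [List.length_cons, mul_add, mul_one]
        omega

lemma exists_bin_packing {ι α : Type} [Fintype ι] [Nonempty ι] (w : α → ℕ) (B : ℕ) (cap : ι → ℕ)
    (P : List α) (hB : ∀ p ∈ P, w p ≤ B)
    (hcap : (P.map w).sum + Fintype.card ι * B ≤ ∑ j, cap j) :
    ∃ a : ι → List α, ∑ j, (a j : Multiset α) = P ∧ ∀ j, ((a j).map w).sum ≤ cap j := by
  classical
  induction P with
  | nil => exact ⟨fun _ => [], by simp, by simp⟩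
  | cons p P ih =>
    simp only [List.map_cons, List.sum_cons] at hcap
    obtain ⟨a, haP, ha⟩ := ih (fun q hq => hB q (List.mem_cons_of_mem _ hq)) (by omega)
    have hsum : ∑ j, ((a j).map w).sum = (P.map w).sum := by
      have := congrArg ((Multiset.sumAddMonoidHom).comp (Multiset.mapAddMonoidHom w)) haP
      rw [map_sum] at this
      simpa using this
    have hex : ∃ j, w p + ((a j).map w).sum ≤ cap j := by
      by_contra! hcon
      have h1 := sum_lt_sum_of_nonempty (univ_nonempty (α := ι)) fun j _ => hcon j
      rw [sum_add_distrib, hsum, sum_const, card_univ, smul_eq_mul] at h1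
      have h2 := Nat.mul_le_mul_left (Fintype.card ι) (hB p List.mem_cons_self)
      omega
    obtain ⟨j, hj⟩ := hex
    refine ⟨Function.update a j (p :: a j), ?_, fun i => ?_⟩
    · rw [← add_sum_erase _ _ (mem_univ j), Function.update_self]
      rw [← add_sum_erase _ _ (mem_univ j)] at haP
      rw [← Multiset.cons_coe, ← Multiset.cons_coe, ← haP, Multiset.cons_add]
      congr 2
      refine sum_congr rfl fun i hi => ?_
      rw [Function.update_of_ne (ne_of_mem_erase hi)]
    · rcases eq_or_ne i j with rfl | hij
      · simpa using hj
      · simpa [hij] using ha i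

lemma IsSpread.exists_disjoint_family (h : IsSpread G s d β e₀) {ι : Type} [Fintype ι]
    [DecidableEq ι] (anchor : ι → Finset V) (q : ι → ℕ) (serve : ι → Finset V → Prop)
    {X U : Finset V} (hXU : Disjoint X U) {Δ : ℕ}
    (hserve : ∀ i Y, s ≤ #Y → (∀ a ∈ anchor i, d ≤ degIn G Y a) →
      ∃ S ⊆ Y, #S = q i ∧ serve i S)
    (hq : ∀ i, q i ≤ Q) (hΔ : ∀ v, #{i | v ∈ anchor i} ≤ Δ) (hX : s + ∑ i, q i ≤ #X)
    (hU : s + β * Δ * Q ≤ #U) (hdeg : ∀ v, d + β * Δ * Q ≤ degIn G U v) :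
    ∃ S : ι → Finset V, (∀ i, S i ⊆ X ∪ U ∧ #(S i) = q i ∧ serve i (S i)) ∧
      Pairwise (Function.onFun Disjoint S) := by
  suffices H : ∀ I : Finset ι, ∃ S : ι → Finset V, (∀ i ∈ I, #(S i) = q i ∧ serve i (S i) ∧
      (S i ⊆ X ∨ S i ⊆ U ∧ ∃ a ∈ anchor i, degIn G (X \ I.biUnion S) a < d)) ∧
      (I : Set ι).PairwiseDisjoint S by
    obtain ⟨S, hS, hd⟩ := H univ
    refine ⟨S, fun i => ?_, fun i j hij => hd (by simp) (by simp) hij⟩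
    obtain ⟨h1, h2, h3⟩ := hS i (mem_univ i)
    refine ⟨?_, h1, h2⟩
    rcases h3 with h3 | ⟨h3, -⟩
    exacts [h3.trans subset_union_left, h3.trans subset_union_right]
  intro I
  induction I using Finset.induction_on with
  | empty => exact ⟨fun _ => ∅, by simp, by simp⟩
  | insert i₀ I hi₀ ih =>
    obtain ⟨S, hS, hd⟩ := ih
    set Y := I.biUnion S with hY
    suffices H : ∃ S₀ : Finset V, Disjoint S₀ Y ∧ #S₀ = q i₀ ∧ serve i₀ S₀ ∧
        (S₀ ⊆ X ∨ S₀ ⊆ U ∧ ∃ a ∈ anchor i₀, degIn G (X \ Y) a < d) by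
      obtain ⟨S₀, hS₀Y, hS₀q, hS₀s, hS₀⟩ := H
      have hne : ∀ i ∈ I, Function.update S i₀ S₀ i = S i := fun i hi =>
        Function.update_of_ne (ne_of_mem_of_not_mem hi hi₀) _ _
      have hYY : (insert i₀ I).biUnion (Function.update S i₀ S₀) = S₀ ∪ Y := by
        rw [biUnion_insert, Function.update_self, biUnion_congr rfl hne]
      have hmono : ∀ a, degIn G (X \ Y) a < d → degIn G (X \ (S₀ ∪ Y)) a < d := fun a ha =>
        (degIn_mono (sdiff_subset_sdiff le_rfl subset_union_right) a).trans_lt ha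
      refine ⟨Function.update S i₀ S₀, fun i hi => ?_, ?_⟩
      · rw [hYY]
        rcases mem_insert.1 hi with rfl | hi
        · rw [Function.update_self]
          exact ⟨hS₀q, hS₀s, hS₀.imp_right fun ⟨h1, a, ha, h2⟩ => ⟨h1, a, ha, hmono a h2⟩⟩
        · rw [hne i hi]
          obtain ⟨h1, h2, h3⟩ := hS i hi
          exact ⟨h1, h2, h3.imp_right fun ⟨h1, a, ha, h2⟩ => ⟨h1, a, ha, hmono a h2⟩⟩
      · rw [coe_insert]
        refine Set.PairwiseDisjoint.insert ?_ fun j hj hij => ?_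
        · intro i hi j hj hij
          simpa only [Function.onFun, hne i hi, hne j hj] using hd hi hj hij
        · rw [Function.update_self, hne j hj]
          exact hS₀Y.mono_right (subset_biUnion_of_mem S hj)
    have hYc : #Y ≤ ∑ i, q i := calc
      #Y ≤ ∑ i ∈ I, #(S i) := card_biUnion_le
      _ = ∑ i ∈ I, q i := sum_congr rfl fun i hi => (hS i hi).1
      _ ≤ ∑ i, q i := sum_le_sum_of_subset (subset_univ _)
    have hXY : s ≤ #(X \ Y) := by
      have := le_card_sdiff Y X
      omega
    by_cases hgood : ∀ a ∈ anchor i₀, d ≤ degIn G (X \ Y) a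
    · obtain ⟨S₀, h1, h2, h3⟩ := hserve i₀ _ hXY hgood
      exact ⟨S₀, (subset_sdiff.1 h1).2, h2, h3, Or.inl (subset_sdiff.1 h1).1⟩
    push Not at hgood
    have hYU : #(Y ∩ U) ≤ β * Δ * Q := by
      have h1 : #{i ∈ I | ¬ S i ⊆ X} ≤ β * Δ := by
        have hsub : ({i ∈ I | ¬ S i ⊆ X} : Finset ι) ⊆
            ({v | degIn G (X \ Y) v < d} : Finset V).biUnion fun v => {i | v ∈ anchor i} := by
          intro i hi
          rw [mem_filter] at hi
          obtain ⟨-, a, ha, had⟩ := (hS i hi.1).2.2.resolve_left hi.2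
          simp only [mem_biUnion, mem_filter, mem_univ, true_and]
          exact ⟨a, had, ha⟩
        refine (card_le_card hsub).trans ((card_biUnion_le_card_mul _ _ Δ fun v _ => hΔ v).trans ?_)
        exact Nat.mul_le_mul_right _ (h.few_bad _ hXY)
      have h2 : Y ∩ U ⊆ ({i ∈ I | ¬ S i ⊆ X} : Finset ι).biUnion S := by
        intro v hv
        rw [mem_inter, hY, mem_biUnion] at hv
        obtain ⟨⟨i, hi, hvi⟩, hvU⟩ := hv
        exact mem_biUnion.2 ⟨i, mem_filter.2 ⟨hi, fun hsub =>
          disjoint_left.1 hXU (hsub hvi) hvU⟩, hvi⟩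
      refine (card_le_card h2).trans ((card_biUnion_le_card_mul _ _ Q fun i hi => ?_).trans
        (Nat.mul_le_mul_right _ h1))
      rw [(hS i (mem_filter.1 hi).1).1]
      exact hq i
    have hUY : s ≤ #(U \ Y) := by
      have := card_sdiff_add_card_inter U Y
      rw [inter_comm] at this
      omega
    obtain ⟨S₀, h1, h2, h3⟩ := hserve i₀ (U \ Y) hUY fun a _ => by
      have h1 := degIn_le_degIn_sdiff_add (G := G) U Y a
      have h2 := hdeg a
      omega
    exact ⟨S₀, (subset_sdiff.1 h1).2, h2, h3, Or.inr ⟨(subset_sdiff.1 h1).1, hgood⟩⟩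

end Assembly

section Segments

variable {V : Type} [Fintype V] [DecidableEq V]

variable {G : SimpleGraph V} [DecidableRel G.Adj] {s d β e₀ Q : ℕ}

lemma List.map_sublist_flatMap {α κ : Type*} (c : κ → α) (g : κ → List α) (l : List κ)
    (h : ∀ y ∈ l, c y ∈ g y) : (l.map c).Sublist (l.flatMap g) := by
  induction l with
  | nil => simp
  | cons y l ih =>
    rw [List.map_cons, List.flatMap_cons, ← List.singleton_append]
    exact (List.singleton_sublist.2 (h y List.mem_cons_self)).append
      (ih fun z hz => h z (List.mem_cons_of_mem _ hz))

lemma IsSpread.exists_absorbers (h : IsSpread G s d β e₀) (hQ : e₀ + β + Q ≤ d) (hβ : β < s)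
    {ι κ : Type} [Fintype ι] [DecidableEq ι] [Fintype κ] (cand : κ → Finset V)
    {D C : ℕ} (hD : ∀ y, #(cand y) ≤ D) (hD' : ∀ x, #{y | x ∈ cand y} ≤ D) (gr : κ → ι)
    (hC : ∀ j, #{y | gr y = j} ≤ C) (hQC : 4 * (C * D) + 1 ≤ Q) {X U : Finset V}
    (hXU : Disjoint X U) (hX : s + (4 * (Fintype.card κ * D) + Fintype.card ι) ≤ #X)
    (hU : s + β * D * Q ≤ #U) (hdeg : ∀ v, d + β * D * Q ≤ degIn G U v) :
    ∃ (S : ι → Finset V) (a b : ι → V), Pairwise (Function.onFun Disjoint S) ∧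
      ∀ j, S j ⊆ X ∪ U ∧ #(S j) ≤ 4 * (C * D) + 1 ∧ a j ∈ S j ∧ b j ∈ S j ∧
        ∀ c : κ → V, (∀ y, c y ∈ cand y) → ∃ l : List V, l.IsChain G.Adj ∧
          l.head? = some (a j) ∧ l.getLast? = some (b j) ∧
          (l : Multiset V) = (S j).val + Multiset.map c ({y | gr y = j} : Finset κ).val := by
  let xs : ι → List V := fun j =>
    ({y | gr y = j} : Finset κ).toList.flatMap fun y => (cand y).toList
  have hxs : ∀ j, (xs j).length = ∑ y with gr y = j, #(cand y) := by
    intro j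
    simp [xs, List.length_flatMap]
  have hlen : ∀ j, 4 * (xs j).length + 1 ≤ 4 * (C * D) + 1 := by
    intro j
    have h1 : ∑ y with gr y = j, #(cand y) ≤ #{y | gr y = j} * D := by
      rw [← smul_eq_mul]
      exact sum_le_card_nsmul _ _ _ fun y _ => hD y
    have h2 := Nat.mul_le_mul_right D (hC j)
    rw [hxs]
    omega
  have hsum : ∑ j, (4 * (xs j).length + 1) ≤ 4 * (Fintype.card κ * D) + Fintype.card ι := by
    rw [sum_add_distrib, ← mul_sum, sum_const, card_univ, smul_eq_mul, mul_one]
    simp only [hxs]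
    rw [sum_fiberwise]
    have h1 : ∑ y, #(cand y) ≤ Fintype.card κ * D := by
      rw [← smul_eq_mul, ← card_univ]
      exact sum_le_card_nsmul _ _ _ fun y _ => hD y
    omega
  obtain ⟨S, hS, hdis⟩ := h.exists_disjoint_family (Q := Q) (fun j => (xs j).toFinset)
    (fun j => 4 * (xs j).length + 1) (fun j S => ∃ a ∈ S, ∃ b ∈ S, IsAbsorber G (xs j) a b S)
    hXU (Δ := D) (fun j Y hY hYd => by
      obtain ⟨S, hSY, hS, a, ha, b, hb, -, hab⟩ := h.exists_absorber hQ hY (by omega) (xs j)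
        (fun x hx => hYd x (List.mem_toFinset.2 hx)) ((hlen j).trans hQC)
      exact ⟨S, hSY, hS, a, ha, b, hb, hab⟩) (fun j => (hlen j).trans hQC)
    (fun v => by
      classical
      refine (card_le_card (t := image gr {y | v ∈ cand y}) fun j hj => ?_).trans
        (card_image_le.trans (hD' v))
      simpa [xs, and_comm] using hj) (by omega) hU hdeg
  choose hSX hSq a ha b hb hab using hS
  refine ⟨S, a, b, hdis, fun j => ⟨hSX j, (hSq j).trans_le (hlen j), ha j, hb j, fun c hc => ?_⟩⟩
  obtain ⟨l, h1, h2, h3, h4⟩ := hab j _ (List.map_sublist_flatMap c (fun y => (cand y).toList)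
    ({y | gr y = j} : Finset κ).toList fun y _ => mem_toList.2 (hc y))
  refine ⟨l, h1, h2, h3, ?_⟩
  rw [h4, ← Multiset.map_coe, coe_toList]

lemma IsSpread.exists_links (h : IsSpread G s d β e₀) (hQ : e₀ + β + Q ≤ d)
    {ι : Type} [Fintype ι] [DecidableEq ι] {a b : ι → V} (ha : Function.Injective a)
    (hb : Function.Injective b) (ps : ι → List (List V))
    (hps : ∀ j, ∀ p ∈ ps j, p ≠ [] ∧ p.IsChain G.Adj)
    (hnd : (∑ j, ((ps j).flatten : Multiset V)).Nodup) (θ : ι → ℕ)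
    (hθ : ∀ j, 2 * ((ps j).length + 1) ≤ θ j) (hθQ : ∀ j, θ j ≤ Q) {X U : Finset V}
    (hXU : Disjoint X U) (hX : s + ∑ j, θ j ≤ #X)
    (hU : s + β * 3 * Q ≤ #U) (hdeg : ∀ v, d + β * 3 * Q ≤ degIn G U v) :
    ∃ S : ι → Finset V, Pairwise (Function.onFun Disjoint S) ∧
      ∀ j, S j ⊆ X ∪ U ∧ #(S j) = θ j ∧ ∃ l : List V, (a j :: l ++ [b j]).IsChain G.Adj ∧
        l ≠ [] ∧ (l : Multiset V) = (S j).val + ((ps j).flatten : Multiset V) := by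
  obtain ⟨S, hS, hdis⟩ := h.exists_disjoint_family (Q := Q)
    (fun j => (a j :: b j :: (ps j).flatten).toFinset) θ
    (fun j S => ∃ l : List V, (a j :: l ++ [b j]).IsChain G.Adj ∧
        l ≠ [] ∧ (l : Multiset V) = S.val + ((ps j).flatten : Multiset V))
    hXU (Δ := 3) (fun j Y hY hYd => by
      simp only [List.mem_toFinset, List.mem_cons, List.mem_flatten] at hYd
      obtain ⟨S, hSY, hS, hl⟩ := h.exists_connection hQ hY (hYd (b j) (by simp)) (ps j)
        (fun p hp => ⟨(hps j p hp).1, (hps j p hp).2,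
          fun v hv => hYd v (Or.inr (Or.inr ⟨p, hp, hv⟩))⟩) (a j) (hYd (a j) (by simp)) ∅ (θ j)
        (hθ j) (by simpa using hθQ j)
      exact ⟨S, by simpa using hSY, hS, hl⟩) hθQ
    (fun v => by
      have h1 : ({j | v ∈ (a j :: b j :: (ps j).flatten).toFinset} : Finset ι) ⊆
          (univ.filter (a · = v) ∪ univ.filter (b · = v)) ∪
            univ.filter fun j => v ∈ (ps j).flatten := by
        intro j
        simp only [List.mem_toFinset, List.mem_cons, mem_filter, mem_univ, true_and, mem_union]
        rintro (rfl | rfl | hv) <;> simp_all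
      have h2 : #{j | a j = v} ≤ 1 := card_le_one.2 fun i hi j hj =>
        ha ((mem_filter.1 hi).2.trans (mem_filter.1 hj).2.symm)
      have h3 : #{j | b j = v} ≤ 1 := card_le_one.2 fun i hi j hj =>
        hb ((mem_filter.1 hi).2.trans (mem_filter.1 hj).2.symm)
      have h4 : #{j | v ∈ (ps j).flatten} ≤ 1 := by
        have h5 := Multiset.nodup_iff_count_le_one.1 hnd v
        rw [Multiset.count_sum'] at h5
        refine le_trans ?_ h5
        rw [card_filter]
        refine sum_le_sum fun j _ => ?_
        split_ifs with hj
        · exact Multiset.one_le_count_iff_mem.2 hj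
        · exact Nat.zero_le _
      have h6 := card_union_le (univ.filter (a · = v) ∪ univ.filter (b · = v))
        (univ.filter fun j => v ∈ (ps j).flatten)
      have h7 := card_union_le (univ.filter (a · = v)) (univ.filter (b · = v))
      have h8 := card_le_card h1
      omega) hX hU hdeg
  exact ⟨S, hdis, hS⟩

lemma exists_balanced_map (κ ι : Type) [Fintype κ] [Fintype ι] [DecidableEq ι] {C : ℕ}
    (h : Fintype.card κ ≤ Fintype.card ι * C) :
    ∃ gr : κ → ι, ∀ j, #{y | gr y = j} ≤ C := by
  obtain ⟨φ⟩ : Nonempty (κ ↪ ι × Fin C) :=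
    Function.Embedding.nonempty_of_card_le (by simpa using h)
  refine ⟨fun y => (φ y).1, fun j => ?_⟩
  calc #{y | (φ y).1 = j} ≤ #(univ : Finset (Fin C)) := by
        refine card_le_card_of_injOn (fun y => (φ y).2) (fun _ _ => mem_coe.2 (mem_univ _)) ?_
        intro y hy z hz hyz
        simp only [coe_filter, mem_univ, true_and, Set.mem_ofPred_eq] at hy hz
        exact φ.injective (Prod.ext (hy.trans hz.symm) hyz)
    _ = C := by simp

lemma sum_val_eq_biUnion {ι α : Type*} [Fintype ι] [DecidableEq α] {S : ι → Finset α}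
    (hS : Pairwise (Function.onFun Disjoint S)) : ∑ j, (S j).val = (univ.biUnion S).val := by
  rw [← disjiUnion_eq_biUnion _ _ fun i _ j _ hij => hS hij]
  rfl

lemma coe_flatten {α : Type*} (L : List (List α)) :
    (L.flatten : Multiset α) = (L.map (Multiset.ofList (α := α))).sum := by
  rw [← Multiset.coe_join, Multiset.join, Multiset.sum_coe]

lemma sum_coe_flatten {ι α : Type*} [Fintype ι] {ps : ι → List (List α)} {P : List (List α)}
    (h : ∑ j, (ps j : Multiset (List α)) = P) :
    ∑ j, ((ps j).flatten : Multiset α) = P.flatten := by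
  have := congrArg (Multiset.sumAddMonoidHom.comp
    (Multiset.mapAddMonoidHom Multiset.ofList)) h
  rw [map_sum] at this
  simp only [AddMonoidHom.comp_apply, Multiset.coe_mapAddMonoidHom, Multiset.map_coe,
    Multiset.coe_sumAddMonoidHom, Multiset.sum_coe] at this
  simpa only [coe_flatten] using this

theorem IsSpread.exists_segments (h : IsSpread G s d β e₀) (hQ : e₀ + β + Q ≤ d) (hβ : β < s)
    {r D Δ : ℕ} (hD : ∀ Z W : Finset V, Disjoint Z W → #Z = 3 * r → #W = 3 * r →
      ∃ cand : Fin (4 * r) → Finset V, (∀ y, cand y ⊆ Z ∪ W) ∧ (∀ y, #(cand y) ≤ D) ∧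
        (∀ x, #{y | x ∈ cand y} ≤ D) ∧ ∀ R ⊆ W, r ≤ #R → ∃ c : Fin (4 * r) → V,
          Function.Injective c ∧ ∀ y, c y ∈ cand y ∧ c y ∈ Z ∪ R)
    (hDΔ : D ≤ Δ) (hΔ : 3 ≤ Δ) {U₁ U₃ : Finset V} (hU : Disjoint U₁ U₃)
    (hU₁ : s + β * Δ * Q ≤ #U₁) (hU₃ : s + β * Δ * Q ≤ #U₃)
    (hd₁ : ∀ v, d + β * Δ * Q ≤ degIn G U₁ v) (hd₃ : ∀ v, d + β * Δ * Q ≤ degIn G U₃ v)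
    (hr : s + #U₃ ≤ r) {ι : Type} [Fintype ι] [DecidableEq ι] [Nonempty ι]
    (hX : 6 * r + #U₁ + (s + (4 * (4 * r * D) + Fintype.card ι)) ≤ Fintype.card V)
    {C f c₀ : ℕ} (hC : 4 * r ≤ Fintype.card ι * C) (σ : Equiv.Perm ι) (k : ι → ℕ)
    (hk : ∀ j, 4 * (C * D) + 1 + C + 2 ≤ k j) (hkQ : ∀ j, k j ≤ Q) (hf : 0 < f) (hfQ : f ≤ Q)
    (hc₀ : Fintype.card V + f * s ≤ f * c₀) (hkn : ∑ j, k j ≤ Fintype.card V)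
    (hcap : Fintype.card V + 2 * c₀ + Fintype.card ι * (f + 4) ≤ ∑ j, k j + 2 * r) :
    ∃ seg : ι → List V, (∀ j, (seg j).IsChain G.Adj ∧ (seg j).length = k j ∧
        ∀ x ∈ (seg j).getLast?, ∀ y ∈ (seg (σ j)).head?, G.Adj x y) ∧
      (∑ j, (seg j : Multiset V)).Nodup := by
  have hD3 : β * D * Q ≤ β * Δ * Q := by gcongr
  have h33 : β * 3 * Q ≤ β * Δ * Q := by gcongr
  -- the reservoir `W` and the fixed part `Z` of the template
  obtain ⟨W, hUW, hWU, hW⟩ := exists_subsuperset_card_eq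
    (subset_sdiff.2 ⟨subset_univ U₃, hU.symm⟩ : U₃ ⊆ univ \ U₁) (by omega : #U₃ ≤ 3 * r) (by
      rw [card_sdiff_of_subset (subset_univ _), card_univ]; omega)
  have hdWU : Disjoint W U₁ := (subset_sdiff.1 hWU).2
  obtain ⟨Z, hZ, hZc⟩ := exists_subset_card_eq (s := univ \ (U₁ ∪ W)) (n := 3 * r) (by
    have := card_union_le U₁ W
    rw [card_sdiff_of_subset (subset_univ _), card_univ]; omega)
  have hZ' := disjoint_union_right.1 (subset_sdiff.1 hZ).2
  obtain ⟨cand, hcZW, hcD, hcD', hcR⟩ := hD Z W hZ'.2 hZc hW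
  obtain ⟨gr, hgr⟩ := exists_balanced_map (Fin (4 * r)) ι (C := C) (by simpa using hC)
  -- the absorbers
  obtain ⟨S, a, b, hSdis, hS⟩ := h.exists_absorbers hQ hβ cand hcD hcD' gr hgr (by
      have j : ι := Classical.arbitrary ι
      have := hk j
      have := hkQ j
      omega) (X := univ \ (U₁ ∪ (Z ∪ W))) (U := U₁)
    (sdiff_disjoint.mono_right subset_union_left) (by
      have h1 := card_union_le U₁ (Z ∪ W)
      have h2 := card_union_le Z W
      rw [card_sdiff_of_subset (subset_univ _), card_univ, Fintype.card_fin]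
      omega) (by omega) (fun v => by have := hd₁ v; omega)
  choose hSX hSc haS hbS hSabs using hS
  have hSZW : Disjoint (univ.biUnion S) (Z ∪ W) := by
    rw [disjoint_biUnion_left]
    refine fun j _ => Disjoint.mono_left (hSX j) ?_
    rw [disjoint_union_left]
    exact ⟨sdiff_disjoint.mono_right subset_union_right,
      disjoint_union_right.2 ⟨hZ'.1.symm, hdWU.symm⟩⟩
  set SS := univ.biUnion S with hSS
  -- the paths covering the leftover vertices
  set F := univ \ (SS ∪ (Z ∪ W)) with hF
  have hZWc : #(Z ∪ W) = 6 * r := by rw [card_union_of_disjoint hZ'.2]; omega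
  have hSSc : #SS = ∑ j, #(S j) := card_biUnion fun i _ j _ hij => hSdis hij
  have hFc : #F + (∑ j, #(S j) + 6 * r) = Fintype.card V := by
    rw [← hSSc, ← hZWc, ← card_union_of_disjoint hSZW, hF,
      card_sdiff_add_card_eq_card (subset_univ _), card_univ]
  obtain ⟨P, hP, hPF, hPc⟩ := h.exists_path_cover hf hβ (by omega) F
  have hPlen : (P.map List.length).sum = #F := by
    rw [← List.length_flatten]
    exact congrArg Multiset.card hPF
  have hPc₀ : P.length ≤ c₀ := Nat.le_of_mul_le_mul_left (by omega) hf
  set φ : ι → ℕ := fun j => #{y | gr y = j} with hφ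
  have hφsum : ∑ j, φ j = 4 * r := by
    have := card_eq_sum_card_fiberwise (s := (univ : Finset (Fin (4 * r)))) (t := univ)
      (f := gr) (fun _ _ => mem_coe.2 (mem_univ _))
    simpa using this.symm
  obtain ⟨ps, hps, hpsc⟩ := exists_bin_packing (fun p : List V => p.length + 2) (f + 2)
    (fun j => k j - (#(S j) + φ j + 2)) P (fun p hp => by have := (hP p hp).2.1; omega) (by
      have h1 : ∑ j, (k j - (#(S j) + φ j + 2)) + ∑ j, (#(S j) + φ j + 2) = ∑ j, k j := by
        rw [← sum_add_distrib]
        refine sum_congr rfl fun j _ => Nat.sub_add_cancel ?_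
        have := hk j
        have := hSc j
        have := hgr j
        simp only [hφ]
        omega
      rw [sum_add_distrib, sum_add_distrib, hφsum, sum_const, card_univ, smul_eq_mul] at h1
      have h2 : (P.map fun p => p.length + 2).sum = #F + 2 * P.length := by
        rw [List.sum_map_add, hPlen, List.map_const', List.sum_replicate, smul_eq_mul, mul_comm]
      rw [h2]
      have h3 : Fintype.card ι * (f + 4) = Fintype.card ι * (f + 2) + Fintype.card ι * 2 := by ring
      omega)
  have hmem : ∀ j, ∀ p ∈ ps j, p ∈ P := fun j p hp => by
    rw [← Multiset.mem_coe, ← hps, Multiset.mem_sum]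
    exact ⟨j, mem_univ _, hp⟩
  have hflat : ∑ j, ((ps j).flatten : Multiset V) = F.val := by
    rw [← hPF, sum_coe_flatten hps]
  -- the links
  set θ : ι → ℕ := fun j => k j - (#(S j) + φ j + (ps j).flatten.length) with hθ
  have hθk : ∀ j, θ j + (#(S j) + φ j + (ps j).flatten.length) = k j ∧
      2 * ((ps j).length + 1) ≤ θ j := by
    intro j
    have h1 := hpsc j
    rw [List.sum_map_add, ← List.length_flatten, List.map_const', List.sum_replicate,
      smul_eq_mul] at h1
    have := hk j
    have := hSc j
    have := hgr j
    simp only [hθ, hφ] at *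
    omega
  have hθsum : ∑ j, θ j + (#F + ∑ j, #(S j) + 4 * r) = ∑ j, k j := by
    have h1 : ∑ j, (ps j).flatten.length = #F := by
      have := congrArg Multiset.card hflat
      rw [Multiset.card_sum] at this
      simpa using this
    rw [← h1, ← hφsum, ← sum_congr rfl fun j _ => (hθk j).1]
    simp only [sum_add_distrib]
    ring
  have ha : Function.Injective a := fun i j hij => by
    by_contra hne
    exact disjoint_left.1 (hSdis hne) (haS i) (hij ▸ haS j)
  have hb : Function.Injective b := fun i j hij => by
    by_contra hne
    exact disjoint_left.1 (hSdis hne) (hbS i) (hij ▸ hbS j)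
  obtain ⟨S', hS'dis, hS'⟩ := h.exists_links hQ hb (ha.comp σ.injective) ps
    (fun j p hp => ⟨(hP p (hmem j p hp)).1, (hP p (hmem j p hp)).2.2⟩)
    (hflat ▸ F.nodup) θ (fun j => (hθk j).2) (fun j => by
      have := (hθk j).1
      have := hkQ j
      omega) (X := W \ U₃) (U := U₃) sdiff_disjoint (by
      have := card_sdiff_add_card_eq_card hUW
      omega) (by omega) (fun v => by have := hd₃ v; omega)
  choose hS'X hS'c l' hl'c hl'ne hl' using hS'
  set SS' := univ.biUnion S' with hSS'
  have hSS'W : SS' ⊆ W := by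
    rw [hSS', biUnion_subset]
    intro j _
    have := hS'X j
    rwa [sdiff_union_of_subset hUW] at this
  have hSS'c : #SS' = ∑ j, θ j := by
    rw [hSS', card_biUnion fun i _ j _ hij => hS'dis hij]
    exact sum_congr rfl fun j _ => hS'c j
  -- absorbing the rest of the reservoir
  obtain ⟨c, hc, hcc⟩ := hcR (W \ SS') sdiff_subset (by
    rw [card_sdiff_of_subset hSS'W]
    omega)
  choose l hl hla hlb hlS using fun j => hSabs j c fun y => (hcc y).1
  refine ⟨fun j => l j ++ l' j, fun j => ⟨?_, ?_, ?_⟩, ?_⟩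
  · have h1 := (List.isChain_append.1 (hl'c j)).1
    rw [List.isChain_cons] at h1
    refine List.isChain_append.2 ⟨hl j, h1.2, fun x hx y hy => ?_⟩
    rw [hlb, Option.mem_some_iff] at hx
    exact hx ▸ h1.1 y hy
  · have h1 := congrArg Multiset.card (hlS j)
    have h2 := congrArg Multiset.card (hl' j)
    have h3 := (hθk j).1
    simp only [Multiset.coe_card, Multiset.card_add, card_val, Multiset.card_map, hS'c] at h1 h2
    rw [List.length_append, h1, h2, ← h3]
    simp only [hφ]
    ring
  · intro x hx y hy
    rw [List.head?_append, hla, Option.some_or, Option.mem_some_iff] at hy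
    rw [List.getLast?_append_of_ne_nil _ (hl'ne j)] at hx
    refine (List.isChain_append.1 (hl'c j)).2.2 x ?_ y (by simpa using hy)
    rw [List.getLast?_cons, Option.mem_def.1 hx]
    rfl
  · have h1 : ∑ j, ((l j ++ l' j : List V) : Multiset V) =
        SS.val + (univ.map ⟨c, hc⟩).val + (SS'.val + F.val) := by
      have h2 : ∑ j, ({y | gr y = j} : Finset (Fin (4 * r))).val = univ.val := by
        rw [sum_val_eq_biUnion fun i j hij => ?_]
        · congr 1
          ext
          simp
        · rw [Function.onFun, disjoint_left]
          intro y hi hj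
          exact hij ((mem_filter.1 hi).2.symm.trans (mem_filter.1 hj).2)
      have h3 := congrArg (Multiset.mapAddMonoidHom c) h2
      rw [map_sum] at h3
      simp only [Multiset.coe_mapAddMonoidHom] at h3
      simp only [← Multiset.coe_add, hlS, hl', sum_add_distrib, hflat, h3,
        sum_val_eq_biUnion hSdis, sum_val_eq_biUnion hS'dis, map_val, Function.Embedding.coeFn_mk,
        hSS, hSS']
    have hcZW : univ.map ⟨c, hc⟩ ⊆ Z ∪ W \ SS' := by
      intro v hv
      obtain ⟨y, -, rfl⟩ := mem_map.1 hv
      exact (hcc y).2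
    have h2 : Disjoint SS (univ.map ⟨c, hc⟩) :=
      hSZW.mono_right (hcZW.trans (union_subset_union_right sdiff_subset))
    have h3 : Disjoint SS' F := by
      rw [hF]
      exact disjoint_sdiff.mono_left
        ((hSS'W.trans subset_union_right).trans subset_union_right)
    have h4 : Disjoint (univ.map ⟨c, hc⟩) SS' := by
      refine Disjoint.mono_left hcZW ?_
      rw [disjoint_union_left]
      exact ⟨hZ'.2.mono_right hSS'W, sdiff_disjoint⟩
    have h5 : Disjoint (univ.map ⟨c, hc⟩) F := by
      rw [hF]
      exact disjoint_sdiff.mono_left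
        ((hcZW.trans (union_subset_union_right sdiff_subset)).trans subset_union_right)
    have h6 : Disjoint SS SS' := hSZW.mono_right (hSS'W.trans subset_union_right)
    have h7 : Disjoint SS F := by
      rw [hF]
      exact disjoint_sdiff.mono_left subset_union_left
    rw [h1, ← disjUnion_val SS _ h2, ← disjUnion_val SS' _ h3, ← disjUnion_val _ _ (by
      simp only [disjUnion_eq_union, disjoint_union_left, disjoint_union_right]
      exact ⟨⟨h6, h4⟩, h7, h5⟩)]
    exact Finset.nodup _

end Segments

section Coloring

variable {V : Type} [Fintype V] [DecidableEq V]

lemma card_few_colored_le {k : ℕ} (hk : 0 < k) (A : Finset V) (c : Fin k) {b : ℕ}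
    (hA : 4 * k * b ≤ #A) :
    (#{χ : V → Fin k | #{v ∈ A | χ v = c} < b} : ℝ) ≤
      (k : ℝ) ^ Fintype.card V * Real.exp (-b) := by
  have hk' : (0 : ℝ) < k := by exact_mod_cast hk
  have hk1 : (1 : ℝ) ≤ k := by exact_mod_cast hk
  have hsum : ∀ v : V, ∑ x : Fin k, (if v ∈ A ∧ x = c then (1 / 2 : ℝ) else 1) =
      if v ∈ A then (k : ℝ) * (1 - 1 / (2 * k)) else k := by
    intro v
    split_ifs with hv
    · have h1 : ∀ x : Fin k, (if v ∈ A ∧ x = c then (1 / 2 : ℝ) else 1) =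
          1 - if x = c then 1 / 2 else 0 := fun x => by
        by_cases hx : x = c <;> norm_num [hv, hx]
      simp only [h1, sum_sub_distrib, sum_ite_eq', mem_univ, if_true, sum_const, card_univ,
        Fintype.card_fin, nsmul_eq_mul, mul_one]
      field_simp
    · simp [hv]
  have hprod : ∑ χ : V → Fin k, ∏ v, (if v ∈ A ∧ χ v = c then (1 / 2 : ℝ) else 1) =
      (k : ℝ) ^ Fintype.card V * (1 - 1 / (2 * k)) ^ #A := by
    have h1 := prod_univ_sum (fun _ : V => (univ : Finset (Fin k)))
      fun v x => if v ∈ A ∧ x = c then (1 / 2 : ℝ) else 1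
    rw [Fintype.piFinset_univ] at h1
    rw [← h1]
    simp only [hsum]
    have h2 : ∀ v : V, (if v ∈ A then (k : ℝ) * (1 - 1 / (2 * k)) else k) =
        k * if v ∈ A then 1 - 1 / (2 * (k : ℝ)) else 1 := fun v => by split_ifs <;> ring
    simp only [h2, prod_mul_distrib, prod_const, card_univ, prod_ite_mem, univ_inter]
  have hlow : (#{χ : V → Fin k | #{v ∈ A | χ v = c} < b} : ℝ) * (1 / 2) ^ b ≤
      ∑ χ : V → Fin k, ∏ v, (if v ∈ A ∧ χ v = c then (1 / 2 : ℝ) else 1) := by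
    rw [← nsmul_eq_mul]
    refine le_trans ?_ (sum_le_sum_of_subset_of_nonneg
      (subset_univ ({χ : V → Fin k | #{v ∈ A | χ v = c} < b} : Finset _)) fun χ _ _ =>
        prod_nonneg fun v _ => by split_ifs <;> norm_num)
    refine card_nsmul_le_sum _ _ _ fun χ hχ => ?_
    rw [prod_ite, prod_const, prod_const_one, mul_one]
    refine pow_le_pow_of_le_one (by norm_num) (by norm_num) ?_
    have h1 : ({v | v ∈ A ∧ χ v = c} : Finset V) = {v ∈ A | χ v = c} := by
      ext v
      simp
    rw [h1]
    exact (mem_filter.1 hχ).2.le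
  have h0 : (0 : ℝ) ≤ 1 - 1 / (2 * k) := by
    rw [sub_nonneg, div_le_one (by positivity)]
    linarith
  have hexp : (1 - 1 / (2 * (k : ℝ))) ^ #A ≤ Real.exp (-b) * Real.exp (-b) := by
    have h1 : 1 - 1 / (2 * (k : ℝ)) ≤ Real.exp (-(1 / (2 * k))) := by
      have := Real.add_one_le_exp (-(1 / (2 * (k : ℝ))))
      linarith
    refine (pow_le_pow_left₀ h0 h1 _).trans ?_
    rw [← Real.exp_nat_mul, ← Real.exp_add, Real.exp_le_exp]
    have h2 : (4 * k * b : ℝ) ≤ #A := by exact_mod_cast hA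
    have h3 : 4 * k * b * (1 / (2 * (k : ℝ))) ≤ #A * (1 / (2 * k)) := by gcongr
    have h4 : 4 * k * b * (1 / (2 * (k : ℝ))) = 2 * b := by field_simp; ring
    linarith
  have htwo : Real.exp (-b) ≤ (1 / 2 : ℝ) ^ b := by
    have h1 : (2 : ℝ) ^ b ≤ Real.exp b := by
      rw [← Real.exp_one_rpow, Real.rpow_natCast]
      have := Real.add_one_le_exp 1
      exact pow_le_pow_left₀ (by norm_num) (by linarith) _
    rw [Real.exp_neg, one_div, inv_pow]
    exact inv_anti₀ (by positivity) h1
  rw [hprod] at hlow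
  have hpos : (0 : ℝ) < (1 / 2) ^ b := by positivity
  refine le_of_mul_le_mul_right (hlow.trans ?_) hpos
  rw [mul_assoc]
  refine mul_le_mul_of_nonneg_left (hexp.trans ?_) (by positivity)
  exact mul_le_mul_of_nonneg_left htwo (Real.exp_pos _).le

lemma exists_balanced_coloring {J : Type} [Fintype J] {k : ℕ} (hk : 0 < k) (A : J → Finset V)
    (b : J → ℕ) (hA : ∀ i, 4 * k * b i ≤ #(A i)) {b₀ : ℕ} (hb : ∀ i, b₀ ≤ b i)
    (hJ : Fintype.card J * k * Real.exp (-b₀) < 1) :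
    ∃ χ : V → Fin k, ∀ i c, b i ≤ #{v ∈ A i | χ v = c} := by
  by_contra! hcon
  have h1 : (univ : Finset (V → Fin k)) ⊆ (univ : Finset (J × Fin k)).biUnion fun ic =>
      {χ | #{v ∈ A ic.1 | χ v = ic.2} < b ic.1} := by
    intro χ _
    obtain ⟨i, c, hic⟩ := hcon χ
    exact mem_biUnion.2 ⟨(i, c), mem_univ _, by simpa using hic⟩
  have h2 := (card_le_card h1).trans card_biUnion_le
  rw [card_univ, Fintype.card_fun, Fintype.card_fin] at h2
  have h3 : ((k ^ Fintype.card V : ℕ) : ℝ) ≤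
      ∑ ic : J × Fin k, (k : ℝ) ^ Fintype.card V * Real.exp (-b₀) := by
    refine (Nat.cast_le.2 h2).trans ?_
    rw [Nat.cast_sum]
    refine sum_le_sum fun ic _ => (card_few_colored_le hk _ _ (hA ic.1)).trans ?_
    gcongr
    exact hb ic.1
  rw [sum_const, card_univ, Fintype.card_prod, Fintype.card_fin, nsmul_eq_mul] at h3
  push_cast at h3
  have h4 : (0 : ℝ) < (k : ℝ) ^ Fintype.card V := by positivity
  nlinarith

end Coloring

section Cycles

variable {V : Type} {G : SimpleGraph V}

lemma SimpleGraph.exists_isCycle_of_isChain {l : List V} (hc : l.IsChain G.Adj) (hnd : l.Nodup)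
    (hl : 3 ≤ l.length) (hadj : ∀ x ∈ l.getLast?, ∀ y ∈ l.head?, G.Adj x y) :
    ∃ (v : V) (c : G.Walk v v), c.IsCycle ∧ c.length = l.length ∧ ∀ x, x ∈ c.support → x ∈ l := by
  have hne : l ≠ [] := by
    rintro rfl
    simp at hl
  have h1 : G.Adj (l.getLast hne) (l.head hne) :=
    hadj _ (List.getLast_mem_getLast? hne) _ (List.head_mem_head? hne)
  have h2 := SimpleGraph.Walk.support_ofSupport hne hc
  have h3 : (SimpleGraph.Walk.ofSupport l hne hc).length + 1 = l.length := by
    rw [← SimpleGraph.Walk.length_support, h2]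
  refine ⟨_, .cons h1 (.ofSupport l hne hc), ?_, ?_, ?_⟩
  · rw [SimpleGraph.Walk.isCycle_iff_isPath_tail_and_le_length, SimpleGraph.Walk.length_cons, h3]
    refine ⟨?_, hl⟩
    rw [SimpleGraph.Walk.isPath_def]
    simpa [h2] using hnd
  · rw [SimpleGraph.Walk.length_cons, h3]
  · intro x hx
    rw [SimpleGraph.Walk.support_cons, h2, List.mem_cons] at hx
    rcases hx with rfl | hx
    exacts [List.getLast_mem hne, hx]

lemma List.exists_cyclic_flatten {α : Type*} {R : α → α → Prop} {m : ℕ} (hm : 0 < m)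
    (seg : Fin m → List α) (hne : ∀ a, seg a ≠ []) (hc : ∀ a, (seg a).IsChain R)
    (hR : ∀ a, ∀ x ∈ (seg a).getLast?, ∀ y ∈ (seg (finRotate m a)).head?, R x y) :
    ∃ l : List α, l.IsChain R ∧ (∀ x ∈ l.getLast?, ∀ y ∈ l.head?, R x y) ∧
      (l : Multiset α) = ∑ a, (seg a : Multiset α) := by
  obtain ⟨m, rfl⟩ := Nat.exists_eq_add_one_of_ne_zero hm.ne'
  refine ⟨(List.ofFn seg).flatten, ?_, ?_, ?_⟩
  · rw [List.isChain_flatten (by simpa only [List.mem_ofFn, not_exists] using hne)]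
    refine ⟨by simpa only [List.forall_mem_ofFn_iff] using hc, ?_⟩
    rw [List.isChain_ofFn]
    intro i hi x hx y hy
    refine hR _ x hx y ?_
    rwa [finRotate_of_lt (by omega)]
  · intro x hx y hy
    rw [List.ofFn_succ', List.concat_eq_append, List.flatten_append, List.flatten_singleton,
      List.getLast?_append_of_ne_nil _ (hne _)] at hx
    rw [List.ofFn_succ, List.flatten_cons, List.head?_append_of_ne_nil _ (hne _)] at hy
    refine hR _ x hx y ?_
    rwa [finRotate_last]
  · rw [coe_flatten, List.map_ofFn, List.sum_ofFn]
    rfl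

lemma exists_isCycle_family_of_segments [DecidableEq V] {I : Type} [Fintype I] [DecidableEq I]
    (ℓ : I → ℕ) {K : ℕ} (hK : 3 ≤ K) (hℓ : ∀ i, K ≤ ℓ i)
    (H : ∀ (ι : Type) [Fintype ι] [DecidableEq ι] (σ : Equiv.Perm ι) (k : ι → ℕ),
      (∀ j, K ≤ k j) → (∀ j, k j ≤ 2 * K) → ∑ j, k j = ∑ i, ℓ i →
      ∃ seg : ι → List V, (∀ j, (seg j).IsChain G.Adj ∧ (seg j).length = k j ∧
        ∀ x ∈ (seg j).getLast?, ∀ y ∈ (seg (σ j)).head?, G.Adj x y) ∧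
      (∑ j, (seg j : Multiset V)).Nodup) :
    ∃ (v : I → V) (c : ∀ i, G.Walk (v i) (v i)), (∀ i, (c i).IsCycle ∧ (c i).length = ℓ i) ∧
      ∀ i j, i ≠ j → Disjoint (c i).support.toFinset (c j).support.toFinset := by
  have hm : ∀ i, 0 < ℓ i / K := fun i => Nat.div_pos (hℓ i) (by omega)
  have hmod : ∀ i, ℓ i % K < K := fun i => Nat.mod_lt _ (by omega)
  let k : (Σ i, Fin (ℓ i / K)) → ℕ := fun j =>
    K + if j.2 = ⟨0, hm j.1⟩ then ℓ j.1 % K else 0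
  have hk : ∀ i, ∑ a, k ⟨i, a⟩ = ℓ i := by
    intro i
    simp only [k, sum_add_distrib, sum_const, card_univ, Fintype.card_fin, smul_eq_mul]
    refine (congrArg _ (sum_ite_eq' univ (⟨0, hm i⟩ : Fin _) fun _ => ℓ i % K)).trans ?_
    rw [if_pos (mem_univ _), mul_comm, Nat.div_add_mod]
  obtain ⟨seg, hseg, hnd⟩ := H (Σ i, Fin (ℓ i / K))
    (Equiv.sigmaCongrRight fun i => finRotate (ℓ i / K)) k (fun j => by simp [k]) (fun j => by
      have := hmod j.1
      simp only [k]
      split_ifs <;> omega) (by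
      rw [Fintype.sum_sigma]
      exact sum_congr rfl fun i _ => hk i)
  rw [Fintype.sum_sigma] at hnd
  have hl := fun i => List.exists_cyclic_flatten (hm i) (fun a => seg ⟨i, a⟩) (fun a hnil => by
      have h1 := (hseg ⟨i, a⟩).2.1
      rw [hnil] at h1
      simp only [List.length_nil, k] at h1
      omega) (fun a => (hseg ⟨i, a⟩).1) fun a => (hseg ⟨i, a⟩).2.2
  choose l hlc hladj hl using hl
  simp only [← hl] at hnd
  have hlen : ∀ i, (l i).length = ℓ i := by
    intro i
    rw [← Multiset.coe_card, hl, Multiset.card_sum]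
    exact (sum_congr rfl fun a _ => (hseg ⟨i, a⟩).2.1).trans (hk i)
  have hlnd : ∀ i, (l i).Nodup := fun i =>
    Multiset.coe_nodup.1 (Multiset.nodup_of_le
      (single_le_sum (f := fun i => (l i : Multiset V)) (fun _ _ => Multiset.zero_le _)
        (mem_univ i)) hnd)
  have hdis : ∀ i j, i ≠ j → ∀ x ∈ l i, x ∉ l j := by
    intro i j hij x hxi hxj
    rw [← add_sum_erase _ _ (mem_univ i), Multiset.nodup_add] at hnd
    refine Multiset.disjoint_left.1 hnd.2.2 (Multiset.mem_coe.2 hxi) (Multiset.mem_sum.2 ?_)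
    exact ⟨j, mem_erase.2 ⟨hij.symm, mem_univ _⟩, hxj⟩
  have hcyc := fun i => SimpleGraph.exists_isCycle_of_isChain (hlc i) (hlnd i)
    ((hK.trans (hℓ i)).trans (hlen i).ge) (hladj i)
  choose v c hc hclen hcsupp using hcyc
  refine ⟨v, c, fun i => ⟨hc i, (hclen i).trans (hlen i)⟩, fun i j hij => ?_⟩
  rw [disjoint_left]
  intro x hxi hxj
  exact hdis i j hij x (hcsupp i x (List.mem_toFinset.1 hxi)) (hcsupp j x (List.mem_toFinset.1 hxj))

end Cycles

section Reservoirs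

variable {V : Type} [Fintype V] [DecidableEq V]

variable {G : SimpleGraph V} [DecidableRel G.Adj] {s d β e₀ : ℕ}

theorem IsSpread.exists_isCycle_family (h : IsSpread G s d β e₀) {D N K r : ℕ}
    (hN : N = 100 * (D + 1)) (hK : K = 4 * N * (16 * N + 4)) (hNr : N * r ≤ Fintype.card V)
    (hrN : Fintype.card V < N * (r + 1)) (hKr : 4 * K ≤ r)
    (hD : ∀ Z W : Finset V, Disjoint Z W → #Z = 3 * r → #W = 3 * r →
      ∃ cand : Fin (4 * r) → Finset V, (∀ y, cand y ⊆ Z ∪ W) ∧ (∀ y, #(cand y) ≤ D) ∧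
        (∀ x, #{y | x ∈ cand y} ≤ D) ∧ ∀ R ⊆ W, r ≤ #R → ∃ c : Fin (4 * r) → V,
          Function.Injective c ∧ ∀ y, c y ∈ cand y ∧ c y ∈ Z ∪ R)
    (hd : e₀ + β + 2 * K ≤ d) (hβ : β < s) (hs : 128 * s ≤ r + 129)
    {U₁ U₃ : Finset V} (hU : Disjoint U₁ U₃) (hU₁r : 8 * #U₁ ≤ r) (hU₃r : 8 * #U₃ ≤ r)
    (hU₁ : s + β * (D + 3) * (2 * K) ≤ #U₁) (hU₃ : s + β * (D + 3) * (2 * K) ≤ #U₃)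
    (hd₁ : ∀ v, d + β * (D + 3) * (2 * K) ≤ degIn G U₁ v)
    (hd₃ : ∀ v, d + β * (D + 3) * (2 * K) ≤ degIn G U₃ v)
    {I : Type} [Fintype I] [DecidableEq I] (ℓ : I → ℕ) (hℓ : ∀ i, K ≤ ℓ i)
    (hn : ∑ i, ℓ i ≤ Fintype.card V) (hn' : Fintype.card V ≤ ∑ i, ℓ i + K) :
    ∃ (v : I → V) (c : ∀ i, G.Walk (v i) (v i)), (∀ i, (c i).IsCycle ∧ (c i).length = ℓ i) ∧
      ∀ i j, i ≠ j → Disjoint (c i).support.toFinset (c j).support.toFinset := by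
  have hN0 : 100 ≤ N := by omega
  have hK0 : 16 * N + 4 ≤ K := by
    rw [hK]
    exact Nat.le_mul_of_pos_left _ (by omega)
  refine exists_isCycle_family_of_segments ℓ (K := K) (by omega) hℓ
    fun ι _ _ σ k hKk hkK hkℓ => ?_
  have hrn : r ≤ N * r := Nat.le_mul_of_pos_left r (by omega)
  set m := Fintype.card ι with hm
  have hKm : K * m ≤ ∑ j, k j := by
    have := card_nsmul_le_sum univ k K fun j _ => hKk j
    rwa [smul_eq_mul, card_univ, mul_comm] at this
  have hmK : ∑ j, k j ≤ 2 * K * m := by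
    have := sum_le_card_nsmul univ k (2 * K) fun j _ => hkK j
    rwa [smul_eq_mul, card_univ, mul_comm] at this
  have hmr : 4 * (m * (16 * N + 4)) < r + 1 := by
    refine lt_of_mul_lt_mul_left (a := N) ?_ (Nat.zero_le _)
    calc N * (4 * (m * (16 * N + 4))) = K * m := by rw [hK]; ring
      _ < N * (r + 1) := by omega
  have hrm : 4 * r ≤ m * (64 * (16 * N + 4)) := by
    have h1 : N * r ≤ N * (m * (16 * (16 * N + 4))) := by
      have h2 : 2 * K * m * 2 = N * (m * (16 * (16 * N + 4))) := by rw [hK]; ring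
      omega
    have := Nat.le_of_mul_le_mul_left h1 (by omega)
    linarith
  have hm0 : 0 < m := by
    rw [Nat.pos_iff_ne_zero]
    intro h0
    rw [h0] at hrm
    omega
  have : Nonempty ι := Fintype.card_pos_iff.1 hm0
  have hmle : m ≤ m * (16 * N + 4) := Nat.le_mul_of_pos_right _ (by omega)
  have hc : 16 * (Fintype.card V / (16 * N)) < r + 1 := by
    refine lt_of_mul_lt_mul_left (a := N) ?_ (Nat.zero_le _)
    have := Nat.mul_div_le (Fintype.card V) (16 * N)
    linarith
  refine h.exists_segments (Q := 2 * K) hd hβ hD (Nat.le_add_right D 3) (Nat.le_add_left 3 D)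
    hU hU₁ hU₃ hd₁ hd₃ (by omega) ?_ (C := 64 * (16 * N + 4)) (f := 16 * N)
    (c₀ := Fintype.card V / (16 * N) + 1 + s) hrm σ k (fun j => ?_) hkK (by omega) (by omega)
    ?_ (hkℓ.trans_le hn) ?_
  · have : 100 * (D * r) + 100 * r ≤ Fintype.card V := by rw [hN] at hNr; linarith
    have h1 : 4 * (4 * r * D) = 16 * (D * r) := by ring
    omega
  · refine le_trans ?_ (hKk j)
    rw [hK]
    generalize hg : 16 * N + 4 = g
    rw [hN]
    have h1 : 1 ≤ g := by omega
    linarith [Nat.zero_le (D * g)]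
  · have := Nat.lt_mul_div_succ (Fintype.card V) (by omega : 0 < 16 * N)
    linarith
  · rw [← hm]
    omega

end Reservoirs

section Bijumbled

lemma ePairs_eq_sum_degIn {V : Type} [DecidableEq V] (G : SimpleGraph V)
    [DecidableRel G.Adj] (A B : Finset V) : ePairs G A B = ∑ a ∈ A, degIn G B a := by
  simp only [ePairs, degIn, card_filter, sum_product]

variable {V : Type} [Fintype V] [DecidableEq V] {G : SimpleGraph V} [DecidableRel G.Adj]
  {p lam ε : ℝ}

lemma Bijumbled.isSpread (hG : Bijumbled G p lam) (hp : 0 < p) (hp1 : p ≤ 1) (hε : 0 < ε)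
    (hlam : lam ≤ ε * p ^ 2 * Fintype.card V) {c ζ : ℝ} (hεζ : ε ≤ ζ) (hεc : 4 * ε ^ 2 ≤ ζ * c)
    {s d β e₀ : ℕ} (hs : c * Fintype.card V ≤ s) (hs₀ : 0 < s) (hds : 2 * (d : ℝ) ≤ p * s)
    (hβ : ζ * p * Fintype.card V < β + 1) (he₀ : ζ * p * Fintype.card V ≤ e₀) (he₀' : 0 < e₀) :
    IsSpread G s d β e₀ := by
  refine ⟨fun X hX => ?_, fun A B hA hB => ?_⟩
  · by_contra! hcon
    set B : Finset V := {v | degIn G X v < d} with hB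
    have hB1 : (β : ℝ) + 1 ≤ #B := by exact_mod_cast hcon
    have hB0 : (0 : ℝ) < #B := by have := β.cast_nonneg (α := ℝ); linarith
    have hX1 : (s : ℝ) ≤ #X := by exact_mod_cast hX
    have hX0 : (0 : ℝ) < #X := lt_of_lt_of_le (by exact_mod_cast hs₀) hX1
    have h1 := (abs_lt.1 (hG B X (card_pos.1 (by omega)) (card_pos.1 (by omega)))).1
    have h2 : (ePairs G B X : ℝ) ≤ #B * (p * #X / 2) := by
      rw [ePairs_eq_sum_degIn, Nat.cast_sum, ← nsmul_eq_mul]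
      refine sum_le_card_nsmul _ _ _ fun v hv => ?_
      have h3 : (degIn G X v : ℝ) ≤ d := by exact_mod_cast (mem_filter.1 hv).2.le
      have h4 : p * s ≤ p * #X := by gcongr
      linarith
    set q := Real.sqrt (#B * #X) with hq
    have hq2 : q * q = #B * #X := Real.mul_self_sqrt (by positivity)
    have hq0 : 0 < q := Real.sqrt_pos.2 (by positivity)
    have h3 : p * q / 2 < lam := by
      refine lt_of_mul_lt_mul_right ?_ hq0.le
      have : p * q / 2 * q = p * (#B * #X) / 2 := by rw [← hq2]; ring
      linarith
    have h4 : q < 2 * ε * p * Fintype.card V := by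
      have : p * q < p * (2 * ε * p * Fintype.card V) := by linarith
      exact lt_of_mul_lt_mul_left this hp.le
    have h5 : q * q < (2 * ε * p * Fintype.card V) * (2 * ε * p * Fintype.card V) :=
      mul_self_lt_mul_self hq0.le h4
    have hn : (0 : ℝ) < Fintype.card V :=
      lt_of_lt_of_le hX0 (by exact_mod_cast card_le_univ X)
    have h6 : ζ * p * Fintype.card V * (c * Fintype.card V) ≤ #B * #X := by
      have hζ : 0 < ζ := hε.trans_le hεζ
      refine mul_le_mul (by linarith) (by linarith) ?_ hB0.le
      have : 0 < ζ * c := by nlinarith [sq_pos_of_pos hε]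
      have : 0 < c := pos_of_mul_pos_right this hζ.le
      positivity
    have h7 : 4 * ε ^ 2 * (p * p * (Fintype.card V) ^ 2) ≤
        ζ * c * (p * 1 * (Fintype.card V) ^ 2) := by
      have : 0 ≤ ζ * c := by nlinarith [sq_nonneg ε]
      gcongr
    nlinarith
  · by_contra! hcon
    have hA0 : (e₀ : ℝ) ≤ #A := by exact_mod_cast hA
    have hB0 : (e₀ : ℝ) ≤ #B := by exact_mod_cast hB
    have he : (0 : ℝ) < e₀ := by exact_mod_cast he₀'
    have h1 := (abs_lt.1 (hG A B (card_pos.1 (by omega)) (card_pos.1 (by omega)))).1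
    have h2 : ePairs G A B = 0 := by
      rw [ePairs, card_eq_zero, filter_eq_empty_iff]
      rintro ⟨a, b⟩ hab
      rw [mem_product] at hab
      exact hcon a hab.1 b hab.2
    rw [h2] at h1
    set q := Real.sqrt (#A * #B) with hq
    have hq2 : q * q = #A * #B := Real.mul_self_sqrt (by positivity)
    have hq0 : 0 < q := Real.sqrt_pos.2 (mul_pos (by linarith) (by linarith))
    have h3 : p * q < lam := by
      refine lt_of_mul_lt_mul_right ?_ hq0.le
      have : p * q * q = p * #A * #B := by rw [mul_assoc, hq2]; ring
      push_cast at h1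
      linarith
    have h4 : (e₀ : ℝ) ≤ q := Real.le_sqrt_of_sq_le (by
      rw [sq]
      exact mul_le_mul hA0 hB0 he.le (by linarith))
    have h5 : p * (ζ * p * Fintype.card V) ≤ p * q :=
      mul_le_mul_of_nonneg_left (by linarith) hp.le
    have h6 : ε * (p ^ 2 * Fintype.card V) ≤ ζ * (p ^ 2 * Fintype.card V) :=
      mul_le_mul_of_nonneg_right hεζ (by positivity)
    linarith

lemma Bijumbled.sqrt_card_le (hG : Bijumbled G p lam) (hp : 0 < p) (hp3 : p ≤ 1 / 3)
    (hε : ε ≤ 2 / 3) (hlam : lam ≤ ε * p ^ 2 * Fintype.card V) {u v : V} (huv : G.Adj u v) :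
    Real.sqrt (Fintype.card V) ≤ p * Fintype.card V := by
  have h1 := (abs_lt.1 (hG {u} {v} (singleton_nonempty u) (singleton_nonempty v))).2
  have h2 : ePairs G {u} {v} = 1 := by
    simp [ePairs, huv, filter_singleton]
  rw [h2] at h1
  simp only [Nat.cast_one, card_singleton, mul_one, Real.sqrt_one] at h1
  have hn : (0 : ℝ) ≤ Fintype.card V := Nat.cast_nonneg _
  have h3 : ε * (p ^ 2 * Fintype.card V) ≤ 2 / 3 * (p ^ 2 * Fintype.card V) := by gcongr
  have h4 : 1 ≤ p ^ 2 * Fintype.card V := by linarith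
  rw [Real.sqrt_le_left (by positivity)]
  nlinarith

end Bijumbled

section Reservoir

variable {V : Type} [Fintype V]

lemma exists_two_small_classes {k : ℕ} (hk : 4 ≤ k) (χ : V → Fin k) :
    ∃ c c' : Fin k, c ≠ c' ∧ k * #{v | χ v = c} ≤ 2 * Fintype.card V ∧
      k * #{v | χ v = c'} ≤ 2 * Fintype.card V := by
  set B : Finset (Fin k) := {c | 2 * Fintype.card V < k * #{v | χ v = c}} with hB
  have hsum : ∑ c, #{v | χ v = c} = Fintype.card V := by
    rw [← card_univ, card_eq_sum_card_fiberwise fun v _ => mem_univ (χ v)]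
  have h1 : #B * (2 * Fintype.card V + 1) ≤ k * Fintype.card V := by
    rw [← smul_eq_mul]
    refine (card_nsmul_le_sum B (fun c => k * #{v | χ v = c}) _
      fun c hc => (mem_filter.1 hc).2).trans ?_
    rw [← mul_sum]
    exact Nat.mul_le_mul_left k ((sum_le_sum_of_subset (subset_univ B)).trans_eq hsum)
  have h2 : 2 * #B ≤ k := by
    by_contra! h
    have : (k + 1) * Fintype.card V ≤ 2 * #B * Fintype.card V := Nat.mul_le_mul_right _ h
    nlinarith
  have h3 : 1 < #Bᶜ := by
    rw [card_compl, Fintype.card_fin]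
    omega
  obtain ⟨c, hc, c', hc', hcc'⟩ := one_lt_card.1 h3
  refine ⟨c, c', hcc', ?_, ?_⟩
  · simpa [hB] using hc
  · simpa [hB] using hc'

lemma exists_reservoirs [DecidableEq V] (G : SimpleGraph V) [DecidableRel G.Adj]
    {k a b : ℕ} (hk : 4 ≤ k) (ha : 4 * k * a ≤ Fintype.card V)
    (hb : ∀ v, 4 * k * b ≤ G.degree v) (hba : b ≤ a)
    (hexp : ((Fintype.card V : ℝ) + 1) * k * Real.exp (-b) < 1) :
    ∃ U₁ U₃ : Finset V, Disjoint U₁ U₃ ∧ k * #U₁ ≤ 2 * Fintype.card V ∧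
      k * #U₃ ≤ 2 * Fintype.card V ∧ a ≤ #U₁ ∧ a ≤ #U₃ ∧ (∀ v, b ≤ degIn G U₁ v) ∧
      ∀ v, b ≤ degIn G U₃ v := by
  obtain ⟨χ, hχ⟩ := exists_balanced_coloring (J := Option V) (k := k) (by omega)
    (fun o => o.elim univ fun v => G.neighborFinset v) (fun o => o.elim a fun _ => b) (b₀ := b)
    (by rintro (_ | v) <;> simp [ha, hb]) (by rintro (_ | v) <;> simp [hba])
    (by simpa using hexp)
  obtain ⟨c, c', hcc', hc, hc'⟩ := exists_two_small_classes hk χ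
  have hdeg : ∀ x v, b ≤ degIn G {u | χ u = x} v := fun x v => by
    refine (hχ (some v) x).trans_eq ?_
    rw [degIn]
    congr 1
    ext u
    simp [and_comm]
  refine ⟨_, _, ?_, hc, hc', hχ none c, hχ none c', hdeg c, hdeg c'⟩
  rw [disjoint_filter]
  rintro v - h h'
  exact hcc' (h.symm.trans h')

end Reservoir

section Parameters

lemma mul_exp_neg_floor_lt_one {a P n k : ℝ} (ha : 0 < a) (hn : 1 ≤ n) (hk : 0 < k)
    (hP : Real.sqrt n ≤ P) (ha2 : 2 ≤ a * Real.sqrt n) (hnk : 768 * k < a ^ 4 * n) :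
    (n + 1) * k * Real.exp (-(⌊a * P⌋₊ : ℕ)) < 1 := by
  set x : ℝ := a * Real.sqrt n / 2 with hx
  have hx0 : 0 ≤ x := by positivity
  have hxb : x ≤ (⌊a * P⌋₊ : ℕ) := by
    have h1 := Nat.lt_floor_add_one (a * P)
    have h2 : a * Real.sqrt n ≤ a * P := mul_le_mul_of_nonneg_left hP ha.le
    linarith
  have h3 := Real.pow_div_factorial_le_exp x hx0 4
  have h4 : x ^ 4 = a ^ 4 * n ^ 2 / 16 := by
    have h5 : Real.sqrt n ^ 2 = n := Real.sq_sqrt (by linarith)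
    calc x ^ 4 = a ^ 4 * (Real.sqrt n ^ 2) ^ 2 / 16 := by rw [hx]; ring
      _ = _ := by rw [h5]
  have h6 : Real.exp x ≤ Real.exp (⌊a * P⌋₊ : ℕ) := Real.exp_le_exp.2 hxb
  rw [Real.exp_neg, ← div_eq_mul_inv, div_lt_one (Real.exp_pos _)]
  refine lt_of_lt_of_le ?_ (h3.trans h6)
  have h7 : ((4).factorial : ℝ) = 24 := by norm_num [Nat.factorial]
  rw [h4, h7]
  have h8 : 768 * k * n < a ^ 4 * n * n := mul_lt_mul_of_pos_right hnk (by linarith)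
  have h9 : k * 1 ≤ k * n := mul_le_mul_of_nonneg_left hn hk.le
  rw [div_div, lt_div_iff₀ (by norm_num)]
  nlinarith

theorem Bijumbled.exists_isCycle_family {δ : ℝ} (hδ : 0 < δ) (hδ1 : δ ≤ 1) :
    ∃ K : ℕ, ∃ ε₁ : ℝ, 0 < ε₁ ∧ ∃ n₀ : ℕ, ∀ p : ℝ, 0 < p → p ≤ 1 / 3 →
    ∀ ε : ℝ, 0 < ε → ε < ε₁ →
    ∀ (V : Type) [Fintype V] [DecidableEq V] (G : SimpleGraph V) [DecidableRel G.Adj],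
      n₀ ≤ Fintype.card V →
      ∀ lam : ℝ, lam ≤ ε * p ^ 2 * Fintype.card V → Bijumbled G p lam →
      (∀ v : V, δ * p * Fintype.card V ≤ G.degree v) →
      ∀ (I : Type) [Fintype I] [DecidableEq I] (ℓ : I → ℕ), (∀ i, K ≤ ℓ i) →
      ∑ i, ℓ i ≤ Fintype.card V → Fintype.card V ≤ ∑ i, ℓ i + K →
      ∃ (v : I → V) (c : ∀ i, G.Walk (v i) (v i)),
        (∀ i, (c i).IsCycle ∧ (c i).length = ℓ i) ∧
        ∀ i j, i ≠ j → Disjoint (c i).support.toFinset (c j).support.toFinset := by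
  obtain ⟨D, hD⟩ := exists_template
  obtain ⟨N, hN⟩ : ∃ N, N = 100 * (D + 1) := ⟨_, rfl⟩
  obtain ⟨K, hK⟩ : ∃ K, K = 4 * N * (16 * N + 4) := ⟨_, rfl⟩
  obtain ⟨M, hM⟩ : ∃ M, M = (D + 3) * (2 * K) := ⟨_, rfl⟩
  have hN0 : 100 ≤ N := by omega
  have hK0 : 0 < K := by rw [hK]; positivity
  have hM1 : 1 ≤ M := by rw [hM]; exact Nat.mul_pos (by omega) (by omega)
  have hN0' : (100 : ℝ) ≤ N := by exact_mod_cast hN0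
  have hM1' : (1 : ℝ) ≤ M := by exact_mod_cast hM1
  obtain ⟨c, hc⟩ : ∃ c : ℝ, c = δ / (128 * N) := ⟨_, rfl⟩
  have hc0 : 0 < c := by rw [hc]; positivity
  have hcN : c * (128 * N) = δ := by rw [hc]; field_simp
  have hc1 : c < 1 := hc ▸ (div_lt_one (by positivity)).2 (by linarith)
  obtain ⟨ζ, hζ⟩ : ∃ ζ : ℝ, ζ = c / (16 * M) := ⟨_, rfl⟩
  have hζ0 : 0 < ζ := by rw [hζ]; positivity
  have hζM : ζ * M = c / 16 := by rw [hζ]; field_simp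
  have hζc : ζ ≤ c / 16 :=
    hζ ▸ div_le_div_of_nonneg_left hc0.le (by norm_num) (by linarith)
  refine ⟨K, min (ζ * c) (1 / 4), by positivity,
    ⌈(8 * (K + 1) / c) ^ 2⌉₊ + 4 * K * N + ⌈768 * (16 * N) / (2 * c) ^ 4⌉₊ + 1, ?_⟩
  intro p hp hp3 ε hε hε₁ V _ _ G _ hn lam hlam hG hdeg I _ _ ℓ hℓ hℓn hnℓ
  obtain ⟨hε1, hε2⟩ := lt_min_iff.1 hε₁
  set n := Fintype.card V with hn_def
  have hn1 : 1 ≤ n := by omega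
  have hn1' : (1 : ℝ) ≤ n := by exact_mod_cast hn1
  have hnK : (8 * (K + 1) / c) ^ 2 ≤ (n : ℝ) :=
    Nat.ceil_le.1 (by omega)
  have hnN : 768 * (16 * N) / (2 * c) ^ 4 < (n : ℝ) :=
    (Nat.le_ceil _).trans_lt (Nat.cast_lt.2 (by omega))
  have hnKN : 4 * K * N ≤ n := by omega
  have hsq : 8 * (K + 1) ≤ c * Real.sqrt n := by
    have := Real.le_sqrt_of_sq_le hnK
    rw [div_le_iff₀ hc0] at this
    linarith
  obtain ⟨P, hP⟩ : ∃ P : ℝ, P = p * n := ⟨_, rfl⟩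
  have hPn : P ≤ n := hP ▸ mul_le_of_le_one_left (Nat.cast_nonneg n) (by linarith)
  have hsP : Real.sqrt n ≤ P := by
    obtain ⟨v⟩ : Nonempty V := Fintype.card_pos_iff.1 hn1
    have h1 : (0 : ℝ) < G.degree v := lt_of_lt_of_le (by positivity) (hdeg v)
    obtain ⟨u, hu⟩ := (G.degree_pos_iff_exists_adj v).1 (by exact_mod_cast h1)
    rw [hP]
    exact hG.sqrt_card_le hp hp3 (by linarith) hlam hu
  have hcP : 8 * (K + 1) ≤ c * P := hsq.trans (mul_le_mul_of_nonneg_left hsP hc0.le)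
  have hK1 : (1 : ℝ) ≤ K := by exact_mod_cast hK0
  have hP0 : 0 < P := by rw [hP]; positivity
  have hcPn : c * P ≤ c * n := mul_le_mul_of_nonneg_left hPn hc0.le
  have hζP : ζ * P ≤ c * P / 16 :=
    (mul_le_mul_of_nonneg_right hζc hP0.le).trans_eq (by ring)
  have hζP0 : 0 < ζ * P := by positivity
  have hζPM : ζ * P * M = c * P / 16 := by rw [mul_right_comm, hζM]; ring
  obtain ⟨s, hs⟩ : ∃ s, s = ⌈c * n⌉₊ := ⟨_, rfl⟩
  obtain ⟨d, hd⟩ : ∃ d, d = ⌊c * P / 2⌋₊ := ⟨_, rfl⟩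
  obtain ⟨β, hβ⟩ : ∃ β, β = ⌊ζ * P⌋₊ := ⟨_, rfl⟩
  obtain ⟨e₀, he₀⟩ : ∃ e₀, e₀ = ⌈ζ * P⌉₊ := ⟨_, rfl⟩
  have hs1 : c * n ≤ s := hs ▸ Nat.le_ceil _
  have hs2 : (s : ℝ) < c * n + 1 := hs ▸ Nat.ceil_lt_add_one (by positivity)
  have hd1 : (d : ℝ) ≤ c * P / 2 := hd ▸ Nat.floor_le (by positivity)
  have hd2 : c * P / 2 < d + 1 := hd ▸ Nat.lt_floor_add_one _
  have hβ1 : (β : ℝ) ≤ ζ * P := hβ ▸ Nat.floor_le hζP0.le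
  have hβ2 : ζ * P < β + 1 := hβ ▸ Nat.lt_floor_add_one _
  have he1 : ζ * P ≤ e₀ := he₀ ▸ Nat.le_ceil _
  have he2 : (e₀ : ℝ) < ζ * P + 1 := he₀ ▸ Nat.ceil_lt_add_one hζP0.le
  have hβM : (β : ℝ) * M ≤ c * P / 16 :=
    (mul_le_mul_of_nonneg_right hβ1 (by linarith)).trans_eq hζPM
  have hζc1 : ζ * c ≤ ζ := mul_le_of_le_one_right hζ0.le hc1.le
  have hε4 : 4 * ε ^ 2 ≤ ζ * c := by
    have : 4 * ε * ε ≤ 1 * ε := mul_le_mul_of_nonneg_right (by linarith) hε.le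
    linarith
  have hspread : IsSpread G s d β e₀ := by
    refine hG.isSpread hp (by linarith) hε hlam (c := c) (ζ := ζ) (by linarith) hε4
      hs1 ?_ ?_ ?_ ?_ ?_
    · exact_mod_cast (lt_of_lt_of_le (by positivity) hs1 : (0 : ℝ) < s)
    · calc 2 * (d : ℝ) ≤ p * (c * n) := by rw [hP] at hd1; linarith
        _ ≤ p * s := mul_le_mul_of_nonneg_left hs1 hp.le
    · rw [mul_assoc, ← hP]; exact hβ2
    · rw [mul_assoc, ← hP]; exact he1
    · exact_mod_cast hζP0.trans_le he1
  have hrN : n < N * (n / N + 1) := by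
    have := Nat.lt_div_mul_add (a := n) (b := N) (by omega)
    linarith
  have hrN' : (n : ℝ) < N * ((n / N : ℕ) + 1) := by exact_mod_cast hrN
  have h16 : ∀ x : ℝ, 0 ≤ x → 4 * (16 * (N : ℝ)) * (⌊2 * c * x⌋₊ : ℕ) ≤ δ * x := fun x hx => by
    have := Nat.floor_le (show 0 ≤ 2 * c * x by positivity)
    calc 4 * (16 * (N : ℝ)) * (⌊2 * c * x⌋₊ : ℕ) ≤ 4 * (16 * (N : ℝ)) * (2 * c * x) := by gcongr
      _ = c * (128 * N) * x := by ring
      _ = δ * x := by rw [hcN]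
  obtain ⟨U₁, U₃, hU, hU₁, hU₃, ha₁, ha₃, hb₁, hb₃⟩ :=
    exists_reservoirs G (k := 16 * N) (a := ⌊2 * c * n⌋₊) (b := ⌊2 * c * P⌋₊) (by omega)
      (by
        have := h16 n (by linarith)
        have h2 : δ * n ≤ n := mul_le_of_le_one_left (Nat.cast_nonneg n) hδ1
        exact_mod_cast this.trans h2)
      (fun v => by
        have h2 := hdeg v
        rw [mul_assoc, ← hP] at h2
        exact_mod_cast (h16 P hP0.le).trans h2)
      (Nat.floor_le_floor (by linarith))
      (by
        push_cast
        refine mul_exp_neg_floor_lt_one (by positivity) hn1' (by positivity) hsP ?_ ?_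
        · linarith
        · rwa [div_lt_iff₀ (by positivity), mul_comm (n : ℝ)] at hnN)
  have hsmall : ∀ x : ℕ, 16 * N * x ≤ 2 * n → 8 * x ≤ n / N := fun x hx => by
    have h1 : N * (8 * x) < N * (n / N + 1) := by linarith
    exact Nat.lt_succ_iff.1 (lt_of_mul_lt_mul_left h1 (Nat.zero_le _))
  have hsa : s + β * (D + 3) * (2 * K) ≤ ⌊2 * c * n⌋₊ := by
    rw [mul_assoc, ← hM]
    refine Nat.le_floor ?_
    push_cast
    linarith
  have hda : d + β * (D + 3) * (2 * K) ≤ ⌊2 * c * P⌋₊ := by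
    rw [mul_assoc, ← hM]
    refine Nat.le_floor ?_
    push_cast
    linarith
  refine hspread.exists_isCycle_family hN hK (r := n / N) (Nat.mul_div_le _ _) hrN ?_
    (hD V (n / N)) ?_ ?_ ?_ hU (hsmall _ hU₁) (hsmall _ hU₃) (hsa.trans ha₁) (hsa.trans ha₃)
    (fun v => hda.trans (hb₁ v)) (fun v => hda.trans (hb₃ v)) ℓ hℓ hℓn hnℓ
  · exact (Nat.le_div_iff_mul_le (by omega)).2 hnKN
  · have : (e₀ : ℝ) + β + 2 * K < d + 1 := by linarith
    exact Nat.lt_succ_iff.1 (by exact_mod_cast this)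
  · have : (β : ℝ) < s := by linarith
    exact_mod_cast this
  · have h1 : 128 * (c * n) ≤ (n / N : ℕ) + 1 := by
      refine le_of_mul_le_mul_left ?_ (show (0 : ℝ) < N by linarith)
      calc N * (128 * (c * n)) = c * (128 * N) * n := by ring
        _ ≤ n := by
          rw [hcN]
          exact mul_le_of_le_one_left (Nat.cast_nonneg n) hδ1
        _ ≤ _ := hrN'.le
    have h2 : 128 * (s : ℝ) < (n / N : ℕ) + 129 := by linarith
    exact le_of_lt (by exact_mod_cast h2)

end Parameters

/-- for every `δ > 0` there are `L ∈ ℕ`, `ε₁ > 0` and `n₀` such that for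
every `p ∈ (0,1/3]` and `0 < ε < ε₁`, every `(p,λ)`-bijumbled graph `G` on `n ≥ n₀`
vertices with `λ ≤ ε p² n` and minimum degree at least `δ p n` contains any family of
vertex-disjoint cycles with lengths in `[L+1,n]` whose lengths sum up to at most `n`. -/
theorem stmt4 (δ : ℝ) (hδ : 0 < δ) :
    ∃ L : ℕ, ∃ ε₁ : ℝ, 0 < ε₁ ∧ ∃ n₀ : ℕ, ∀ p : ℝ, 0 < p → p ≤ 1 / 3 →
    ∀ ε : ℝ, 0 < ε → ε < ε₁ →
    ∀ (V : Type) [Fintype V] [DecidableEq V] (G : SimpleGraph V) [DecidableRel G.Adj]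
      (n : ℕ), Fintype.card V = n → n₀ ≤ n →
      ∀ lam : ℝ, lam ≤ ε * p ^ 2 * n → Bijumbled G p lam →
      (∀ v : V, δ * p * n ≤ (G.degree v : ℝ)) →
      ∀ (t : ℕ) (ℓ : Fin t → ℕ), (∀ i, L + 1 ≤ ℓ i ∧ ℓ i ≤ n) → ∑ i, ℓ i ≤ n →
      ∃ (v : Fin t → V) (c : ∀ i, G.Walk (v i) (v i)),
        (∀ i, (c i).IsCycle ∧ (c i).length = ℓ i) ∧
        (∀ i j, i ≠ j → Disjoint (c i).support.toFinset (c j).support.toFinset) := by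
  obtain ⟨K, ε₁, hε₁, n₀, h⟩ :=
    Bijumbled.exists_isCycle_family (lt_min hδ one_pos) (min_le_right δ 1)
  refine ⟨K, ε₁, hε₁, n₀, ?_⟩
  rintro p hp hp3 ε hε hεε₁ V _ _ G _ _ rfl hn lam hlam hG hdeg t ℓ hℓ hsum
  set e := (Fintype.card V - ∑ i, ℓ i) / (K + 1) with he
  have h1 : e * (K + 1) ≤ Fintype.card V - ∑ i, ℓ i := Nat.div_mul_le_self _ _
  have h2 : Fintype.card V - ∑ i, ℓ i < e * (K + 1) + (K + 1) :=
    Nat.lt_div_mul_add (Nat.succ_pos K)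
  have h3 : ∑ i : Fin t ⊕ Fin e, Sum.elim ℓ (fun _ => K + 1) i = ∑ i, ℓ i + e * (K + 1) := by
    simp [Fintype.sum_sum_type]
  obtain ⟨v, c, hc, hdisj⟩ := h p hp hp3 ε hε hεε₁ V G hn lam hlam hG
    (fun v => le_trans (by gcongr; exact min_le_left _ _) (hdeg v)) (Fin t ⊕ Fin e)
    (Sum.elim ℓ fun _ => K + 1)
    (by
      rintro (i | i)
      · exact (Nat.le_succ K).trans (hℓ i).1
      · exact Nat.le_succ K)
    (by omega) (by omega)
  exact ⟨fun i => v (.inl i), fun i => c (.inl i), fun i => hc (.inl i),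
    fun i j hij => hdisj _ _ (Sum.inl_injective.ne hij)⟩
end

section
/- For every ε ∈ (0,1) there exists n₀ ∈ ℕ such that the following holds: if G is a (p,λ)-bijumbled graph on n ≥ n₀ vertices with λ ≤ ε p² n and ε p ≤ 1/2, then p ≥ (ε² n)^{−1/3} / 4. -/
open Finset

theorem ePairs_singleton_neighborFinset {V : Type} [Fintype V] [DecidableEq V]
    (G : SimpleGraph V) [DecidableRel G.Adj] (v : V) :
    ePairs G {v} (G.neighborFinset v) = G.degree v := by
  rw [ePairs, filter_true_of_mem, card_product, card_singleton, one_mul,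
    SimpleGraph.card_neighborFinset_eq_degree]
  rintro ⟨a, b⟩ hab
  simp only [mem_product, mem_singleton, SimpleGraph.mem_neighborFinset] at hab
  exact hab.1 ▸ hab.2

theorem ePairs_univ {V : Type} [Fintype V] [DecidableEq V]
    (G : SimpleGraph V) [DecidableRel G.Adj] :
    ePairs G univ univ = ∑ v, G.degree v := by
  rw [ePairs, card_filter, sum_product]
  refine sum_congr rfl fun v _ => ?_
  rw [← card_filter, ← SimpleGraph.card_neighborFinset_eq_degree,
    SimpleGraph.neighborFinset_eq_filter]

theorem Bijumbled.pos {V : Type} [Fintype V] [DecidableEq V] [Nonempty V]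
    {G : SimpleGraph V} [DecidableRel G.Adj] {p lam : ℝ} (h : Bijumbled G p lam) :
    0 < lam := by
  obtain ⟨v⟩ := ‹Nonempty V›
  have hv := h {v} {v} (singleton_nonempty v) (singleton_nonempty v)
  simp only [card_singleton, Nat.cast_one, mul_one, Real.sqrt_one] at hv
  exact (abs_nonneg _).trans_lt hv

theorem Bijumbled.degree_mul_sq_le {V : Type} [Fintype V] [DecidableEq V]
    {G : SimpleGraph V} [DecidableRel G.Adj] {p lam : ℝ} (h : Bijumbled G p lam)
    (hp : p ≤ 1) (v : V) : (G.degree v : ℝ) * (1 - p) ^ 2 ≤ lam ^ 2 := by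
  rcases (G.neighborFinset v).eq_empty_or_nonempty with h0 | h0
  · rw [← SimpleGraph.card_neighborFinset_eq_degree, h0]
    simpa using sq_nonneg lam
  have hv := (le_abs_self _).trans_lt (h {v} _ (singleton_nonempty v) h0)
  have hd : (0 : ℝ) < G.degree v := by
    rw [← SimpleGraph.card_neighborFinset_eq_degree]
    exact_mod_cast h0.card_pos
  rw [ePairs_singleton_neighborFinset, card_singleton,
    SimpleGraph.card_neighborFinset_eq_degree, Nat.cast_one, mul_one, one_mul] at hv
  have hs := Real.sqrt_pos.2 hd
  have hss := Real.sq_sqrt hd.le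
  set s := Real.sqrt (G.degree v)
  have hlt : s * (1 - p) < lam := by
    refine lt_of_mul_lt_mul_right ?_ hs.le
    calc s * (1 - p) * s = s ^ 2 * (1 - p) := by ring
      _ = G.degree v - p * G.degree v := by rw [hss]; ring
      _ < lam * s := hv
  rw [← hss, ← mul_pow]
  exact pow_le_pow_left₀ (mul_nonneg hs.le (by linarith)) hlt.le 2

theorem Bijumbled.density_le {V : Type} [Fintype V] [DecidableEq V] [Nonempty V]
    {G : SimpleGraph V} [DecidableRel G.Adj] {p lam : ℝ} (h : Bijumbled G p lam)
    (hp : p ≤ 1) :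
    (p * Fintype.card V - lam) * (1 - p) ^ 2 ≤ lam ^ 2 := by
  have hn : (0 : ℝ) < Fintype.card V := by exact_mod_cast Fintype.card_pos
  have hu := (abs_lt.1 (h univ univ univ_nonempty univ_nonempty)).1
  rw [ePairs_univ, card_univ, Real.sqrt_mul_self hn.le, Nat.cast_sum] at hu
  have hsum : (∑ v, (G.degree v : ℝ)) * (1 - p) ^ 2 ≤ Fintype.card V * lam ^ 2 := by
    rw [sum_mul]
    calc ∑ v, (G.degree v : ℝ) * (1 - p) ^ 2 ≤ ∑ _v : V, lam ^ 2 :=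
          sum_le_sum fun v _ => h.degree_mul_sq_le hp v
      _ = Fintype.card V * lam ^ 2 := by simp
  refine le_of_mul_le_mul_left ?_ hn
  calc (Fintype.card V : ℝ) * ((p * Fintype.card V - lam) * (1 - p) ^ 2)
      = (p * Fintype.card V * Fintype.card V - lam * Fintype.card V) * (1 - p) ^ 2 := by ring
    _ ≤ (∑ v, (G.degree v : ℝ)) * (1 - p) ^ 2 :=
        mul_le_mul_of_nonneg_right (by linarith) (sq_nonneg _)
    _ ≤ _ := hsum

/-- for every `ε ∈ (0,1)` there is `n₀` such that every `(p,λ)`-bijumbled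
graph on `n ≥ n₀` vertices (with density `p ∈ (0,1]`) satisfying `λ ≤ ε p² n` and
`ε p ≤ 1/2` has `p ≥ (ε² n)^{-1/3} / 4`. -/
theorem stmt6 (ε : ℝ) (hε : 0 < ε) (hε1 : ε < 1) :
    ∃ n₀ : ℕ, ∀ (V : Type) [Fintype V] [DecidableEq V]
      (G : SimpleGraph V) [DecidableRel G.Adj] (p lam : ℝ),
      0 < p → p ≤ 1 → n₀ ≤ Fintype.card V →
      Bijumbled G p lam → lam ≤ ε * p ^ 2 * Fintype.card V → ε * p ≤ 1 / 2 →
      (ε ^ 2 * (Fintype.card V : ℝ)) ^ (-(1 / 3) : ℝ) / 4 ≤ p := by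
  refine ⟨⌈1 / ε ^ 2⌉₊, fun V _ _ G _ p lam hp hp1 hn h hlam hεp => ?_⟩
  by_contra! hlt
  have hx : 1 ≤ ε ^ 2 * (Fintype.card V : ℝ) := by
    have := (div_le_iff₀ (by positivity)).1 (Nat.ceil_le.1 hn)
    linarith
  have hn0 : (0 : ℝ) < Fintype.card V := by
    by_contra! h0
    nlinarith [sq_nonneg ε]
  have : Nonempty V := Fintype.card_pos_iff.1 (by exact_mod_cast hn0)
  set n : ℝ := (Fintype.card V : ℝ)
  have hy1 : (ε ^ 2 * n) ^ (-(1 / 3) : ℝ) ≤ 1 :=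
    Real.rpow_le_one_of_one_le_of_nonpos hx (by norm_num)
  have hy3 : ((ε ^ 2 * n) ^ (-(1 / 3) : ℝ)) ^ 3 * (ε ^ 2 * n) = 1 := by
    rw [← Real.rpow_natCast, ← Real.rpow_mul (by positivity)]
    norm_num
    rw [Real.rpow_neg_one]
    field_simp
  set y := (ε ^ 2 * n) ^ (-(1 / 3) : ℝ)
  have hp3 : 64 * p ^ 3 * (ε ^ 2 * n) ≤ 1 := by
    have := pow_le_pow_left₀ hp.le hlt.le 3
    rw [div_pow] at this
    rw [← hy3]
    exact mul_le_mul_of_nonneg_right (by linarith) (by linarith)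
  have hpn : 0 < p * n := mul_pos hp hn0
  have hlam_sq : 64 * lam ^ 2 ≤ p * n :=
    calc 64 * lam ^ 2 ≤ 64 * (ε * p ^ 2 * n) ^ 2 := by
          have := pow_le_pow_left₀ h.pos.le hlam 2
          linarith
      _ = 64 * p ^ 3 * (ε ^ 2 * n) * (p * n) := by ring
      _ ≤ p * n := mul_le_of_le_one_left hpn.le hp3
  have hlam_half : lam ≤ p * n / 2 :=
    calc lam ≤ ε * p * (p * n) := by linarith
      _ ≤ 1 / 2 * (p * n) := mul_le_mul_of_nonneg_right hεp hpn.le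
      _ = p * n / 2 := by ring
  have hq : (1 / 2 : ℝ) ≤ (1 - p) ^ 2 := by nlinarith
  have hmul : p * n / 2 * (1 / 2) ≤ (p * n - lam) * (1 - p) ^ 2 :=
    mul_le_mul (by linarith) hq (by norm_num) (by linarith)
  linarith [h.density_le hp1]
end

section
/- Let ε > 0, ℓ ∈ ℕ with ℓ ≥ 1, and let G be a (p,λ)-bijumbled graph on n vertices with p ∈ (0,1], λ ≤ ε p² n, and ε p n ≥ 1. If A and B are vertex subsets each of size at least 2^{ℓ−1} ε p n and C is a vertex subset of size at least 2^{ℓ−1} ε n, then G contains a path P of length ℓ (i.e., with ℓ edges) whose one endpoint lies in A, whose other endpoint lies in B, and all of whose inner vertices lie in C. -/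
open Finset

theorem ePairs_eq_sum_card_filter {V : Type} [DecidableEq V] (G : SimpleGraph V)
    [DecidableRel G.Adj] (A B : Finset V) :
    ePairs G A B = ∑ a ∈ A, (B.filter (G.Adj a)).card := by
  simp only [ePairs, card_filter, sum_product]

/-- In a `(p,λ)`-bijumbled graph, if every vertex of `A` has at most `q |B|` neighbours in `B`, then
`(p - q) √(|A||B|) < λ`. -/
theorem Bijumbled.mul_sqrt_lt {V : Type} [Fintype V] [DecidableEq V] {G : SimpleGraph V}
    [DecidableRel G.Adj] {p lam q : ℝ} (hG : Bijumbled G p lam) {A B : Finset V}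
    (hA : A.Nonempty) (hB : B.Nonempty)
    (hq : ∀ a ∈ A, ((B.filter (G.Adj a)).card : ℝ) ≤ q * B.card) :
    (p - q) * Real.sqrt (A.card * B.card) < lam := by
  have hA' : (0 : ℝ) < A.card := by exact_mod_cast hA.card_pos
  have hB' : (0 : ℝ) < B.card := by exact_mod_cast hB.card_pos
  have he : (ePairs G A B : ℝ) ≤ A.card * (q * B.card) := by
    rw [ePairs_eq_sum_card_filter, Nat.cast_sum, ← nsmul_eq_mul]
    exact sum_le_card_nsmul A _ _ hq
  have h := (abs_lt.mp (hG A B hA hB)).1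
  have hs : 0 < Real.sqrt (A.card * B.card) := Real.sqrt_pos.mpr (mul_pos hA' hB')
  have hss := Real.mul_self_sqrt (mul_pos hA' hB').le
  refine lt_of_mul_lt_mul_right ?_ hs.le
  rw [mul_assoc, hss]
  linarith

theorem card_sub_one_le_card_erase {V : Type} [DecidableEq V] (S : Finset V) (a : V) :
    (S.card : ℝ) - 1 ≤ (S.erase a).card := by
  rw [sub_le_iff_le_add]
  exact_mod_cast Nat.sub_le_iff_le_add.mp (pred_card_le_card_erase (s := S) (a := a))

/-- in a `(p,λ)`-bijumbled graph with `p ∈ (0,1]`, `λ ≤ ε p² n` and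
`ε p n ≥ 1`, given sets `A, B` of size at least `2^{ℓ-1} ε p n` and `C` of size at least
`2^{ℓ-1} ε n`, there is an `A`–`B`-path of length `ℓ` whose inner vertices lie in `C`. -/
theorem stmt9 {V : Type} [Fintype V] [DecidableEq V] (G : SimpleGraph V)
    [DecidableRel G.Adj] (ε p lam : ℝ) (ℓ : ℕ) (hℓ : 1 ≤ ℓ)
    (hε : 0 < ε) (hp : 0 < p) (hp1 : p ≤ 1)
    (hlam : lam ≤ ε * p ^ 2 * Fintype.card V) (hG : Bijumbled G p lam)
    (hpn : 1 ≤ ε * p * Fintype.card V)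
    (A B C : Finset V)
    (hA : 2 ^ (ℓ - 1) * ε * p * (Fintype.card V : ℝ) ≤ A.card)
    (hB : 2 ^ (ℓ - 1) * ε * p * (Fintype.card V : ℝ) ≤ B.card)
    (hC : 2 ^ (ℓ - 1) * ε * (Fintype.card V : ℝ) ≤ C.card) :
    ∃ (a b : V) (P : G.Walk a b), a ∈ A ∧ b ∈ B ∧ P.IsPath ∧ P.length = ℓ ∧
      ∀ v ∈ P.support, v ≠ a → v ≠ b → v ∈ C := by
  obtain ⟨k, rfl⟩ := Nat.exists_eq_add_of_le' hℓ
  clear hℓ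
  simp only [Nat.add_sub_cancel] at hA hB hC
  have hle : ε * p * Fintype.card V ≤ ε * Fintype.card V := by
    rw [mul_right_comm]
    exact mul_le_of_le_one_right (by positivity) hp1
  have hn : 1 ≤ ε * Fintype.card V := hpn.trans hle
  have nonempty_of_le : ∀ {S : Finset V} {x : ℝ}, 0 < x → x ≤ S.card → S.Nonempty :=
    fun hx h => card_pos.mp (by exact_mod_cast hx.trans_le h)
  induction k generalizing A B C with
  | zero =>
    simp only [pow_zero, one_mul] at hA hB
    have hA0 := nonempty_of_le (by linarith) hA
    have hB0 := nonempty_of_le (by linarith) hB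
    obtain ⟨a, ha, b, hb, hab⟩ : ∃ a ∈ A, ∃ b ∈ B, G.Adj a b := by
      by_contra! h
      have h1 := hG.mul_sqrt_lt (q := 0) hA0 hB0 fun a ha => by
        simp [filter_eq_empty_iff.mpr fun b hb => h a ha b hb]
      have h2 : ε * p * Fintype.card V ≤ Real.sqrt (A.card * B.card) := by
        apply Real.le_sqrt_of_sq_le
        rw [sq]
        exact mul_le_mul hA hB (by linarith) (by positivity)
      nlinarith [mul_le_mul_of_nonneg_left h2 hp.le]
    refine ⟨a, b, hab.toWalk, ha, hb, by simp [hab.ne], by simp, ?_⟩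
    intro v hv hva hvb
    simp [hva, hvb] at hv
  | succ k ih =>
    have hpow : (1 : ℝ) ≤ 2 ^ k := one_le_pow₀ one_le_two
    have h1 : 1 ≤ 2 ^ k * ε * p * (Fintype.card V : ℝ) := by
      nlinarith [mul_le_mul_of_nonneg_right hpow (zero_le_one.trans hpn)]
    have h2 : 1 ≤ 2 ^ k * ε * (Fintype.card V : ℝ) := by
      nlinarith [mul_le_mul_of_nonneg_right hpow (zero_le_one.trans hn)]
    rw [pow_succ] at hA hB hC
    have hA0 := nonempty_of_le (by linarith) hA
    have hC0 := nonempty_of_le (by linarith) hC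
    obtain ⟨a, ha, hdeg⟩ : ∃ a ∈ A, p / 2 * C.card < (C.filter (G.Adj a)).card := by
      by_contra! h
      have h3 := hG.mul_sqrt_lt hA0 hC0 h
      have h4 : 2 * (ε * p * Fintype.card V) ≤ Real.sqrt (A.card * C.card) := by
        apply Real.le_sqrt_of_sq_le
        have hA2 : 2 * (ε * p * Fintype.card V) ≤ A.card := by
          nlinarith [mul_le_mul_of_nonneg_right hpow (zero_le_one.trans hpn)]
        have hC2 : 2 * (ε * p * Fintype.card V) ≤ C.card := by
          nlinarith [mul_le_mul_of_nonneg_right hpow (zero_le_one.trans hn)]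
        rw [sq]
        exact mul_le_mul hA2 hC2 (by linarith) (by positivity)
      nlinarith [mul_le_mul_of_nonneg_left h4 hp.le]
    obtain ⟨x, b, P, hx, hb, hP, hlen, hin⟩ := ih (C.filter (G.Adj a)) (B.erase a) (C.erase a)
      (by nlinarith [mul_le_mul_of_nonneg_left hC hp.le])
      (by linarith [card_sub_one_le_card_erase B a])
      (by linarith [card_sub_one_le_card_erase C a])
    obtain ⟨hxC, hax⟩ := mem_filter.mp hx
    obtain ⟨hba, hbB⟩ := mem_erase.mp hb
    refine ⟨a, b, P.cons hax, ha, hbB, ?_, by simp [hlen], ?_⟩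
    · refine hP.cons fun hmem => ?_
      exact notMem_erase a C (hin a hmem hax.ne hba.symm)
    · intro v hv hva hvb
      rw [SimpleGraph.Walk.support_cons, List.mem_cons] at hv
      by_cases hvx : v = x
      · exact hvx ▸ hxC
      · exact mem_of_mem_erase (hin v (hv.resolve_left hva) hvx hvb)
end

section
/- Let ε > 0 and let G be a (p,λ)-bijumbled graph on n vertices with p ∈ (0, 1/2] and λ ≤ ε p² n. If U is a vertex subset of size greater than ε n, then for every integer ℓ with 0 ≤ ℓ ≤ |U| − ε n, the induced subgraph G[U] contains a path of length ℓ (i.e., a path with ℓ edges all of whose vertices lie in U). -/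
open Finset

/-- A nonempty duplicate-free list of successively adjacent vertices is the support of a path. -/
theorem exists_isPath_support_eq_cons {V : Type} (G : SimpleGraph V) (l : List V) (a : V)
    (hc : (a :: l).IsChain G.Adj) (hn : (a :: l).Nodup) :
    ∃ (b : V) (P : G.Walk a b), P.IsPath ∧ P.support = a :: l := by
  suffices h : ∃ (b : V) (P : G.Walk a b), P.support = a :: l by
    obtain ⟨b, P, hP⟩ := h
    exact ⟨b, P, SimpleGraph.Walk.IsPath.mk' (hP ▸ hn), hP⟩
  clear hn
  induction l generalizing a with
  | nil => exact ⟨a, .nil, by simp⟩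
  | cons c l ih =>
    rw [List.isChain_cons_cons] at hc
    obtain ⟨b, P, hP⟩ := ih c hc.2
    exact ⟨b, .cons hc.1 P, by simp [hP]⟩

/-- Depth-first search inside `U`, stopped after `k` steps: `L` is the current path,
`S` the set of explored vertices and `T` the set of unvisited ones. -/
theorem exists_dfs_state {V : Type} [DecidableEq V] (G : SimpleGraph V) (U : Finset V)
    (k : ℕ) (hk : k ≤ U.card) :
    ∃ (L : List V) (S T : Finset V), L.IsChain G.Adj ∧ L.Nodup ∧ (∀ v ∈ L, v ∈ U) ∧
      T ⊆ U ∧ (∀ v ∈ L, v ∉ S) ∧ (∀ v ∈ L, v ∉ T) ∧ Disjoint S T ∧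
      (∀ s ∈ S, ∀ t ∈ T, ¬ G.Adj s t) ∧
      L.length + S.card + T.card = U.card ∧ T.card + k = S.card + U.card := by
  induction k with
  | zero => exact ⟨[], ∅, U, by simp⟩
  | succ k ih =>
    obtain ⟨L, S, T, hc, hn, hLU, hTU, hLS, hLT, hdisj, hST, hcard, hdiff⟩ := ih (by omega)
    have push : ∀ w ∈ T, (w :: L).IsChain G.Adj →
        ∃ (L : List V) (S T : Finset V), L.IsChain G.Adj ∧ L.Nodup ∧ (∀ v ∈ L, v ∈ U) ∧
          T ⊆ U ∧ (∀ v ∈ L, v ∉ S) ∧ (∀ v ∈ L, v ∉ T) ∧ Disjoint S T ∧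
          (∀ s ∈ S, ∀ t ∈ T, ¬ G.Adj s t) ∧
          L.length + S.card + T.card = U.card ∧ T.card + (k + 1) = S.card + U.card := by
      intro w hw hch
      have hwS : w ∉ S := fun h => disjoint_left.1 hdisj h hw
      have hT := card_erase_add_one hw
      refine ⟨w :: L, S, T.erase w, hch, List.nodup_cons.2 ⟨fun h => hLT w h hw, hn⟩,
        ?_, (erase_subset _ _).trans hTU, ?_, ?_, hdisj.mono_right (erase_subset _ _), ?_, ?_, ?_⟩
      · simpa using ⟨hTU hw, hLU⟩
      · simpa using ⟨hwS, hLS⟩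
      · intro v hv
        rcases List.mem_cons.1 hv with rfl | hv
        · simp
        · exact fun h => hLT v hv (mem_of_mem_erase h)
      · exact fun s hs t ht => hST s hs t (mem_of_mem_erase ht)
      · simp only [List.length_cons]
        omega
      · omega
    cases L with
    | nil =>
      obtain ⟨w, hw⟩ := card_pos.1 (show 0 < T.card by omega)
      exact push w hw (by simp)
    | cons v L =>
      by_cases h : ∃ w ∈ T, G.Adj w v
      · obtain ⟨w, hw, hwv⟩ := h
        exact push w hw (List.isChain_cons_cons.2 ⟨hwv, hc⟩)
      · have hvS : v ∉ S := hLS v (by simp)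
        rw [List.nodup_cons] at hn
        have hS := card_insert_of_notMem hvS
        simp only [List.length_cons] at hcard
        refine ⟨L, insert v S, T, hc.tail, hn.2, fun x hx => hLU x (by simp [hx]), hTU,
          ?_, fun x hx => hLT x (by simp [hx]), ?_, ?_, by omega, by omega⟩
        · intro x hx hxS
          rcases mem_insert.1 hxS with rfl | hxS
          · exact hn.1 hx
          · exact hLS x (by simp [hx]) hxS
        · exact disjoint_insert_left.2 ⟨hLT v (by simp), hdisj⟩
        · intro s hs t ht hst
          rcases mem_insert.1 hs with rfl | hs
          · exact h ⟨t, ht, hst.symm⟩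
          · exact hST s hs t ht hst

/-- in a `(p,λ)`-bijumbled graph with `p ∈ (0,1/2]` and `λ ≤ ε p² n`, any
vertex set `U` with `|U| > ε n` contains a path of any length `ℓ ≤ |U| − ε n`. -/
theorem stmt11 {V : Type} [Fintype V] [DecidableEq V] (G : SimpleGraph V)
    [DecidableRel G.Adj] (ε p lam : ℝ) (hε : 0 < ε) (hp : 0 < p) (hp2 : p ≤ 1 / 2)
    (hlam : lam ≤ ε * p ^ 2 * Fintype.card V) (hG : Bijumbled G p lam)
    (U : Finset V) (hU : ε * (Fintype.card V : ℝ) < U.card)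
    (ℓ : ℕ) (hℓ : (ℓ : ℝ) ≤ (U.card : ℝ) - ε * Fintype.card V) :
    ∃ (a b : V) (P : G.Walk a b), P.IsPath ∧ P.length = ℓ ∧
      ∀ v ∈ P.support, v ∈ U := by
  obtain ⟨L, S, T, hc, hn, hLU, -, -, -, -, hST, hcard, hdiff⟩ :=
    exists_dfs_state G U U.card le_rfl
  have hTS : T.card = S.card := by omega
  have hnV : (0 : ℝ) < Fintype.card V := by
    rw [Nat.cast_pos, Fintype.card_pos_iff]
    have : 0 < U.card := by
      rw [← Nat.cast_pos (α := ℝ)]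
      exact lt_of_le_of_lt (by positivity) hU
    exact (card_pos.1 this).to_type
  have hεn := mul_pos hε hnV
  have hS : 2 * (S.card : ℝ) < ε * Fintype.card V := by
    rcases S.eq_empty_or_nonempty with rfl | hSne
    · simpa using hεn
    · have hs : (0 : ℝ) < S.card := by exact_mod_cast hSne.card_pos
      have hTne : T.Nonempty := card_pos.1 (hTS ▸ hSne.card_pos)
      have he : ePairs G S T = 0 := by
        rw [ePairs, card_eq_zero, filter_eq_empty_iff]
        intro x hx
        rw [mem_product] at hx
        exact hST _ hx.1 _ hx.2
      have hb := hG S T hSne hTne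
      rw [he, hTS, Real.sqrt_mul_self hs.le, Nat.cast_zero, zero_sub, abs_neg,
        abs_of_nonneg (by positivity)] at hb
      have h1 : p * S.card < p * (p * (ε * Fintype.card V)) := by
        have := lt_of_mul_lt_mul_right hb hs.le
        linarith
      have h2 := lt_of_mul_lt_mul_left h1 hp.le
      nlinarith
  have hlen : ℓ < L.length := by
    have h : (L.length : ℝ) + S.card + S.card = U.card := by
      rw [hTS] at hcard
      exact_mod_cast hcard
    rw [← Nat.cast_lt (α := ℝ)]
    linarith
  cases L with
  | nil => simp at hlen
  | cons a L =>
    have hsub := List.take_sublist (ℓ + 1) (a :: L)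
    have hc' := hc.take (ℓ + 1)
    have hn' := hn.sublist hsub
    rw [List.take_succ_cons] at hsub hc' hn'
    obtain ⟨b, P, hP, hsupp⟩ := exists_isPath_support_eq_cons G _ a hc' hn'
    refine ⟨a, b, P, hP, ?_, fun v hv => hLU v (hsub.subset (hsupp ▸ hv))⟩
    have := P.length_support
    rw [hsupp, List.length_cons, List.length_take] at this
    simp only [List.length_cons] at hlen
    omega
end
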